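/- Let p > −(n+1) and let K ⊂ ℝ^{n+1} be a smooth, strictly convex body with the origin in its interior whose support function h satisfies 𝒦 = h^{1−p} on S^n. If the centroid of K is at the origin, then K is a ball centred at the origin. -/

import Mathlib

open MeasureTheory Metric
open scoped RealInnerProductSpace ENNReal

noncomputable section

abbrev E (n : ℕ) : Type := EuclideanSpace ℝ (Fin (n + 1))

/-- The Hessian of `H` as a continuous linear map. -/
def hess {n : ℕ} (H : E n → ℝ) (x : E n) : E n →L[ℝ] E n :=
  fderiv ℝ (gradient H) x

/-- The rank-one projection `y ↦ ⟪x, y⟫ • x`. -/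
def proj {n : ℕ} (x : E n) : E n →L[ℝ] E n :=
  ((innerSL ℝ) x).smulRight x

/-- `σ_n = det(∇̄²h + h ḡ)/det ḡ = 1/𝒦`, computed as the determinant of
`D²H + x ⊗ x` where `H` is the 1-homogeneous extension of the support function. -/
def sigmaDet {n : ℕ} (H : E n → ℝ) (x : E n) : ℝ :=
  LinearMap.det ((hess H x + proj x) : E n →L[ℝ] E n).toLinearMap

/-- Tangential (spherical) gradient of the restriction to the unit sphere. -/
def tgrad {n : ℕ} (F : E n → ℝ) (x : E n) : E n :=
  gradient F x - ⟪gradient F x, x⟫ • x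

/-- The convex body with support function `H`. -/
def body {n : ℕ} (H : E n → ℝ) : Set (E n) :=
  {y | ∀ x ∈ sphere (0 : E n) 1, ⟪y, x⟫ ≤ H x}

section

open Set Filter Topology

open scoped Pointwise in
theorem volume_add_volume_le_two_mul {A B C : Set ℝ} (hA : MeasurableSet A)
    (hB : MeasurableSet B) (hA' : A.Nonempty) (hB' : B.Nonempty)
    (h : ∀ a ∈ A, ∀ b ∈ B, (a + b) / 2 ∈ C) : volume A + volume B ≤ 2 * volume C := by
  have key : ∀ K ⊆ A, IsCompact K → K.Nonempty → ∀ L ⊆ B, IsCompact L → L.Nonempty →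
      volume K + volume L ≤ 2 * volume C := by
    intro K hKA hK hK' L hLB hL hL'
    obtain ⟨a, ha⟩ := hK.exists_isGreatest hK'
    obtain ⟨b, hb⟩ := hL.exists_isLeast hL'
    have h1 : volume ((fun x => b + x) '' K) = volume K := by simp
    have h2 : volume ((fun x => a + x) '' L) = volume L := by simp
    have hsub : (fun x => b + x) '' K ∪ (fun x => a + x) '' L ⊆ (2 : ℝ) • C := by
      rintro _ (⟨x, hx, rfl⟩ | ⟨x, hx, rfl⟩)
      · exact ⟨_, h x (hKA hx) b (hLB hb.1), by simp only [smul_eq_mul]; ring⟩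
      · exact ⟨_, h a (hKA ha.1) x (hLB hx), by simp only [smul_eq_mul]; ring⟩
    have hint : volume ((fun x => b + x) '' K ∩ (fun x => a + x) '' L) = 0 := by
      refine measure_mono_null (t := {a + b}) ?_ (by simp)
      rintro _ ⟨⟨x, hx, rfl⟩, ⟨y, hy, hxy⟩⟩
      have := ha.2 hx
      have := hb.2 hy
      simp only [mem_singleton_iff] at *
      linarith
    have hmeas : MeasurableSet ((fun x => a + x) '' L) :=
      (hL.image (by fun_prop)).measurableSet
    calc volume K + volume L
        = volume ((fun x => b + x) '' K ∪ (fun x => a + x) '' L) := by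
          rw [← h1, ← h2, ← measure_union_add_inter _ hmeas, hint, add_zero]
      _ ≤ volume ((2 : ℝ) • C) := measure_mono hsub
      _ = 2 * volume C := by
          rw [Measure.addHaar_smul]; simp
  obtain ⟨a, ha⟩ := hA'
  obtain ⟨b, hb⟩ := hB'
  rw [hA.measure_eq_iSup_isCompact, hB.measure_eq_iSup_isCompact]
  simp only [iSup_and']
  refine ENNReal.biSup_add_biSup_le' ⟨∅, by simp⟩ ⟨∅, by simp⟩ ?_
  rintro K ⟨hKA, hK⟩ L ⟨hLB, hL⟩
  refine le_trans (add_le_add (measure_mono (subset_insert a K))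
    (measure_mono (subset_insert b L))) ?_
  exact key _ (insert_subset ha hKA) (hK.insert a) (insert_nonempty _ _) _
    (insert_subset hb hLB) (hL.insert b) (insert_nonempty _ _)

theorem ENNReal.four_mul_le_add_sq (x y : ℝ≥0∞) : 4 * (x * y) ≤ (x + y) ^ 2 := by
  by_cases hx : x = ∞
  · simp [hx]
  by_cases hy : y = ∞
  · simp [hy]
  lift x to NNReal using hx
  lift y to NNReal using hy
  norm_cast
  have := sq_nonneg ((x : ℝ) - y)
  rw [← NNReal.coe_le_coe]
  push_cast
  nlinarith

theorem lintegral_eq_lintegral_meas_lt_of_le_one {f : ℝ → ℝ≥0∞} (hf : Measurable f)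
    (h1 : ∀ x, f x ≤ 1) :
    ∫⁻ x, f x = ∫⁻ t in Ioi (0 : ℝ), volume {x | ENNReal.ofReal t < f x} := by
  have hfin : ∀ x, f x ≠ ∞ := fun x => ne_top_of_le_ne_top ENNReal.one_ne_top (h1 x)
  have := lintegral_eq_lintegral_meas_lt volume (f := fun x => (f x).toReal)
    (Eventually.of_forall fun x => ENNReal.toReal_nonneg) hf.ennreal_toReal.aemeasurable
  simp only [ENNReal.ofReal_toReal (hfin _)] at this
  rw [this]
  refine setLIntegral_congr_fun measurableSet_Ioi fun t ht => ?_
  congr 1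
  ext x
  exact (ENNReal.ofReal_lt_iff_lt_toReal (le_of_lt ht) (hfin x)).symm

theorem lintegral_add_lintegral_le_two_mul {f g m : ℝ → ℝ≥0∞} (hf : Measurable f)
    (hg : Measurable g) (hm : Measurable m) (hf1 : ⨆ x, f x = 1) (hg1 : ⨆ x, g x = 1)
    (h : ∀ x y, f x * g y ≤ m ((x + y) / 2) ^ 2) :
    (∫⁻ x, f x) + ∫⁻ x, g x ≤ 2 * ∫⁻ x, m x := by
  have hf1' : ∀ x, f x ≤ 1 := fun x => hf1 ▸ le_iSup f x
  have hg1' : ∀ x, g x ≤ 1 := fun x => hg1 ▸ le_iSup g x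
  have hmm : ∫⁻ x, min (m x) 1 ≤ ∫⁻ x, m x := lintegral_mono fun x => min_le_left _ _
  refine le_trans ?_ (mul_le_mul_right hmm 2)
  rw [lintegral_eq_lintegral_meas_lt_of_le_one hf hf1',
    lintegral_eq_lintegral_meas_lt_of_le_one hg hg1',
    lintegral_eq_lintegral_meas_lt_of_le_one (hm.min measurable_const) fun x => min_le_right _ _]
  have anti : ∀ k : ℝ → ℝ≥0∞, Measurable fun t : ℝ => volume {x | ENNReal.ofReal t < k x} := by
    intro k
    refine Antitone.measurable fun s t hst => measure_mono fun x hx => ?_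
    exact lt_of_le_of_lt (ENNReal.ofReal_le_ofReal hst) hx
  rw [← lintegral_add_left (anti f), ← lintegral_const_mul _ (anti _)]
  refine setLIntegral_mono' measurableSet_Ioi fun t ht => ?_
  rcases lt_or_ge (ENNReal.ofReal t) 1 with ht1 | ht1
  · refine volume_add_volume_le_two_mul (measurableSet_lt measurable_const hf)
      (measurableSet_lt measurable_const hg) (lt_iSup_iff.1 (ht1.trans_eq hf1.symm) :)
      (lt_iSup_iff.1 (ht1.trans_eq hg1.symm) :) fun a ha b hb => ?_
    refine lt_min ?_ ht1
    by_contra hcon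
    have h1 := h a b
    have h2 : m ((a + b) / 2) ^ 2 ≤ ENNReal.ofReal t ^ 2 := by gcongr; exact not_lt.1 hcon
    have h3 : ENNReal.ofReal t ^ 2 < f a * g b := by
      rw [sq]; exact ENNReal.mul_lt_mul ha hb
    exact absurd (h1.trans h2) (not_le.2 h3)
  · have e1 : {x | ENNReal.ofReal t < f x} = ∅ :=
      eq_empty_of_forall_notMem fun x hx => not_lt.2 ((hf1' x).trans ht1) hx
    have e2 : {x | ENNReal.ofReal t < g x} = ∅ :=
      eq_empty_of_forall_notMem fun x hx => not_lt.2 ((hg1' x).trans ht1) hx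
    simp [e1, e2]

theorem prekopa_leindler_of_bounded {f g m : ℝ → ℝ≥0∞} (hf : Measurable f)
    (hg : Measurable g) (hm : Measurable m) (hfb : ⨆ x, f x ≠ ∞) (hgb : ⨆ x, g x ≠ ∞)
    (h : ∀ x y, f x * g y ≤ m ((x + y) / 2) ^ 2) :
    (∫⁻ x, f x) * ∫⁻ x, g x ≤ (∫⁻ x, m x) ^ 2 := by
  set a := ⨆ x, f x with ha
  set b := ⨆ x, g x with hb
  by_cases ha0 : a = 0
  · have : ∀ x, f x = 0 := by simpa [ha] using ha0
    simp [this]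
  by_cases hb0 : b = 0
  · have : ∀ x, g x = 0 := by simpa [hb] using hb0
    simp [this]
  obtain ⟨c, hc⟩ : ∃ c : ℝ≥0∞, c ^ 2 = a * b :=
    ⟨(a * b) ^ (1 / 2 : ℝ), by rw [← ENNReal.rpow_natCast, ← ENNReal.rpow_mul]; norm_num⟩
  have hab0 : a * b ≠ 0 := mul_ne_zero ha0 hb0
  have habt : a * b ≠ ∞ := ENNReal.mul_ne_top hfb hgb
  have key := lintegral_add_lintegral_le_two_mul (f := fun x => a⁻¹ * f x)
    (g := fun x => b⁻¹ * g x) (m := fun x => c⁻¹ * m x) (hf.const_mul _) (hg.const_mul _)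
    (hm.const_mul _) (by rw [← ENNReal.mul_iSup, ← ha, ENNReal.inv_mul_cancel ha0 hfb])
    (by rw [← ENNReal.mul_iSup, ← hb, ENNReal.inv_mul_cancel hb0 hgb]) (by
      intro x y
      calc a⁻¹ * f x * (b⁻¹ * g y) = (a * b)⁻¹ * (f x * g y) := by
            rw [ENNReal.mul_inv (Or.inl ha0) (Or.inl hfb)]; ring
        _ ≤ (a * b)⁻¹ * m ((x + y) / 2) ^ 2 := by gcongr; exact h x y
        _ = _ := by rw [mul_pow, ← ENNReal.inv_pow, hc])
  rw [lintegral_const_mul _ hf, lintegral_const_mul _ hg, lintegral_const_mul _ hm] at key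
  set F := ∫⁻ x, f x
  set G := ∫⁻ x, g x
  set M := ∫⁻ x, m x
  have h4 : 4 * ((a * b)⁻¹ * (F * G)) ≤ 4 * ((a * b)⁻¹ * M ^ 2) := by
    calc 4 * ((a * b)⁻¹ * (F * G)) = 4 * ((a⁻¹ * F) * (b⁻¹ * G)) := by
          rw [ENNReal.mul_inv (Or.inl ha0) (Or.inl hfb)]; ring
      _ ≤ (a⁻¹ * F + b⁻¹ * G) ^ 2 := ENNReal.four_mul_le_add_sq _ _
      _ ≤ (2 * (c⁻¹ * M)) ^ 2 := by gcongr
      _ = 4 * ((c ^ 2)⁻¹ * M ^ 2) := by rw [ENNReal.inv_pow]; ring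
      _ = _ := by rw [hc]
  rw [ENNReal.mul_le_mul_iff_right (by norm_num) (by norm_num),
    ENNReal.mul_le_mul_iff_right (by simpa using habt) (by simpa using hab0)] at h4
  exact h4

theorem lintegral_eq_iSup_lintegral_min {f : ℝ → ℝ≥0∞} (hf : Measurable f) :
    ∫⁻ x, f x = ⨆ k : ℕ, ∫⁻ x, min (f x) k := by
  rw [← lintegral_iSup (fun k => hf.min measurable_const)]
  · congr with x
    rw [← inf_iSup_eq, ENNReal.iSup_natCast, inf_top_eq]
  · intro i j hij x
    simp only
    gcongr

theorem prekopa_leindler_real {f g m : ℝ → ℝ≥0∞} (hf : Measurable f)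
    (hg : Measurable g) (hm : Measurable m)
    (h : ∀ x y, f x * g y ≤ m ((x + y) / 2) ^ 2) :
    (∫⁻ x, f x) * ∫⁻ x, g x ≤ (∫⁻ x, m x) ^ 2 := by
  rw [lintegral_eq_iSup_lintegral_min hf, lintegral_eq_iSup_lintegral_min hg, ENNReal.iSup_mul]
  refine iSup_le fun k => ?_
  rw [ENNReal.mul_iSup]
  refine iSup_le fun j => prekopa_leindler_of_bounded (hf.min measurable_const)
    (hg.min measurable_const) hm ?_ ?_ fun x y => ?_
  · exact ne_top_of_le_ne_top (ENNReal.natCast_ne_top k) (iSup_le fun x => min_le_right _ _)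
  · exact ne_top_of_le_ne_top (ENNReal.natCast_ne_top j) (iSup_le fun x => min_le_right _ _)
  · exact le_trans (mul_le_mul' (min_le_left _ _) (min_le_left _ _)) (h x y)

theorem lintegral_fin_succ {N : ℕ} {f : (Fin (N + 1) → ℝ) → ℝ≥0∞} (hf : Measurable f) :
    ∫⁻ x, f x = ∫⁻ s : ℝ, ∫⁻ x : Fin N → ℝ, f (Fin.cons s x) := by
  have hmp := (volume_preserving_piFinSuccAbove (fun _ : Fin (N + 1) => ℝ) 0).symm
  rw [← hmp.lintegral_comp hf, Measure.volume_eq_prod,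
    lintegral_prod (fun a => f ((MeasurableEquiv.piFinSuccAbove (fun _ => ℝ) 0).symm a))
      (hf.comp hmp.measurable).aemeasurable]
  simp [MeasurableEquiv.piFinSuccAbove, Fin.insertNthEquiv, Fin.insertNth_zero']

theorem measurable_fin_cons {N : ℕ} :
    Measurable fun p : ℝ × (Fin N → ℝ) => (Fin.cons p.1 p.2 : Fin (N + 1) → ℝ) := by
  refine measurable_pi_iff.2 fun i => ?_
  refine Fin.cases ?_ (fun j => ?_) i
  · simpa using measurable_fst
  · simp only [Fin.cons_succ]; fun_prop

theorem prekopa_leindler_pi : ∀ {N : ℕ} {f g m : (Fin N → ℝ) → ℝ≥0∞}, Measurable f →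
    Measurable g → Measurable m →
    (∀ x y, f x * g y ≤ m ((1 / 2 : ℝ) • (x + y)) ^ 2) →
    (∫⁻ x, f x) * ∫⁻ x, g x ≤ (∫⁻ x, m x) ^ 2 := by
  intro N
  induction N with
  | zero =>
    intro f g m hf hg hm h
    have := h 0 0
    rw [Subsingleton.elim ((1 / 2 : ℝ) • (0 + 0) : Fin 0 → ℝ) 0] at this
    simpa [volume_pi, Measure.pi_of_empty _ (0 : Fin 0 → ℝ)] using this
  | succ N ih =>
    intro f g m hf hg hm h
    rw [lintegral_fin_succ hf, lintegral_fin_succ hg, lintegral_fin_succ hm]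
    refine prekopa_leindler_real (hf.comp measurable_fin_cons).lintegral_prod_right'
      (hg.comp measurable_fin_cons).lintegral_prod_right'
      (hm.comp measurable_fin_cons).lintegral_prod_right' fun s t => ?_
    refine ih (hf.comp (measurable_fin_cons.comp measurable_prodMk_left))
      (hg.comp (measurable_fin_cons.comp measurable_prodMk_left))
      (hm.comp (measurable_fin_cons.comp measurable_prodMk_left)) fun x y => ?_
    refine (h _ _).trans_eq ?_
    congr 2
    ext i
    refine Fin.cases ?_ (fun j => ?_) i
    · simp; ring
    · simp; ring

theorem prekopa_leindler {N : ℕ} {f g m : EuclideanSpace ℝ (Fin N) → ℝ≥0∞} (hf : Measurable f)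
    (hg : Measurable g) (hm : Measurable m)
    (h : ∀ x y, f x * g y ≤ m ((1 / 2 : ℝ) • (x + y)) ^ 2) :
    (∫⁻ x, f x) * ∫⁻ x, g x ≤ (∫⁻ x, m x) ^ 2 := by
  have hmp := PiLp.volume_preserving_toLp (Fin N)
  rw [← hmp.lintegral_comp hf, ← hmp.lintegral_comp hg, ← hmp.lintegral_comp hm]
  refine prekopa_leindler_pi (hf.comp hmp.measurable) (hg.comp hmp.measurable)
    (hm.comp hmp.measurable) fun x y => ?_
  exact h _ _

theorem exists_bound_of_homogeneous {n k : ℕ} {g : E n → ℝ} (hg : ContinuousOn g {0}ᶜ)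
    (hhom : ∀ (t : ℝ) (x : E n), 0 < t → x ≠ 0 → g (t • x) = t ^ k * g x) :
    ∃ C, 0 ≤ C ∧ ∀ x, x ≠ 0 → |g x| ≤ C * ‖x‖ ^ k := by
  have hsub : sphere (0 : E n) 1 ⊆ {0}ᶜ := by
    intro x hx h0
    simp only [mem_singleton_iff] at h0
    simp [h0] at hx
  obtain ⟨C, hC⟩ := (isCompact_sphere (0 : E n) 1).exists_bound_of_continuousOn (hg.mono hsub)
  have key : ∀ x, x ≠ 0 → |g x| ≤ C * ‖x‖ ^ k := by
    intro x hx
    have hx' : 0 < ‖x‖ := norm_pos_iff.2 hx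
    have h1 : g x = ‖x‖ ^ k * g (‖x‖⁻¹ • x) := by
      rw [← hhom _ _ hx' (smul_ne_zero (inv_ne_zero hx'.ne') hx), smul_smul,
        mul_inv_cancel₀ hx'.ne', one_smul]
    have h2 := hC (‖x‖⁻¹ • x) (by simp [norm_smul, hx'.ne'])
    rw [Real.norm_eq_abs] at h2
    rw [h1, abs_mul, abs_of_pos (by positivity : 0 < ‖x‖ ^ k), mul_comm]
    gcongr
  refine ⟨|C|, abs_nonneg _, fun x hx => (key x hx).trans ?_⟩
  gcongr
  exact le_abs_self C

theorem exists_pos_lower_bound_of_homogeneous {n k : ℕ} {g : E n → ℝ}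
    (hg : ContinuousOn g {0}ᶜ)
    (hhom : ∀ (t : ℝ) (x : E n), 0 < t → x ≠ 0 → g (t • x) = t ^ k * g x)
    (hpos : ∀ x, x ≠ 0 → 0 < g x) :
    ∃ c, 0 < c ∧ ∀ x, x ≠ 0 → c * ‖x‖ ^ k ≤ g x := by
  obtain ⟨C, hC0, hC⟩ := exists_bound_of_homogeneous (k := 0) (g := fun x => ‖x‖ ^ k / g x)
    ((by fun_prop : ContinuousOn (fun x : E n => ‖x‖ ^ k) {0}ᶜ).div hg
      fun x hx => (hpos x hx).ne') (by
      intro t x ht hx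
      have := (hpos x hx).ne'
      rw [hhom t x ht hx, norm_smul, Real.norm_of_nonneg ht.le]
      field_simp
      rw [mul_pow])
  refine ⟨(C + 1)⁻¹, by positivity, fun x hx => ?_⟩
  have h1 := (le_abs_self _).trans (hC x hx)
  simp only [pow_zero, mul_one] at h1
  rw [div_le_iff₀ (hpos x hx)] at h1
  rw [inv_mul_le_iff₀ (by positivity)]
  nlinarith [hpos x hx]

theorem fderiv_homogeneous {n k : ℕ} {F : Type*} [NormedAddCommGroup F] [NormedSpace ℝ F]
    {g : E n → F} (hg : DifferentiableOn ℝ g {0}ᶜ)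
    (hhom : ∀ (t : ℝ) (x : E n), 0 < t → x ≠ 0 → g (t • x) = t ^ (k + 1) • g x)
    (t : ℝ) (x : E n) (ht : 0 < t) (hx : x ≠ 0) :
    fderiv ℝ g (t • x) = t ^ k • fderiv ℝ g x := by
  have hd : ∀ y : E n, y ≠ 0 → DifferentiableAt ℝ g y := fun y hy =>
    hg.differentiableAt (isOpen_compl_singleton.mem_nhds hy)
  have htx : t • x ≠ 0 := smul_ne_zero ht.ne' hx
  have h1 : HasFDerivAt (fun y => g (t • y))
      ((fderiv ℝ g (t • x)).comp (t • ContinuousLinearMap.id ℝ (E n))) x :=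
    (hd _ htx).hasFDerivAt.comp x ((hasFDerivAt_id x).const_smul t)
  have h2 : HasFDerivAt (fun y => g (t • y)) (t ^ (k + 1) • fderiv ℝ g x) x := by
    refine ((hd x hx).hasFDerivAt.const_smul (t ^ (k + 1))).congr_of_eventuallyEq ?_
    filter_upwards [isOpen_compl_singleton.mem_nhds hx] with y hy
    exact hhom t y ht hy
  ext e
  have h3 := congrArg (fun L : E n →L[ℝ] F => L e) (h1.unique h2)
  simp only [ContinuousLinearMap.comp_apply, smul_apply,
    ContinuousLinearMap.id_apply, map_smul] at h3
  rw [smul_apply, ← smul_right_inj (ht.ne' : t ≠ 0), h3, smul_smul, pow_succ']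

theorem integrable_exp_neg_mul_norm_sq {n : ℕ} {c : ℝ} (hc : 0 < c) :
    Integrable fun x : E n => Real.exp (-c * ‖x‖ ^ 2) := by
  have := (GaussianFourier.integrable_cexp_neg_mul_sq_norm_add (V := E n) (b := c)
    (by simpa using hc) 0 0).norm
  refine this.congr (Eventually.of_forall fun x => ?_)
  simp only [Complex.norm_exp]
  congr 1
  simp [← Complex.ofReal_pow, ← Complex.ofReal_mul, ← Complex.ofReal_neg]

theorem exists_pow_mul_exp_neg_le (k : ℕ) {c : ℝ} (hc : 0 < c) :
    ∃ K, 0 ≤ K ∧ ∀ r : ℝ, 0 ≤ r →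
      r ^ k * Real.exp (-c * r ^ 2) ≤ K * Real.exp (-(c / 2) * r ^ 2) := by
  refine ⟨(2 / c) ^ k * k.factorial * Real.exp (c / 2), by positivity, fun r hr => ?_⟩
  have h1 : r ^ k ≤ (1 + r ^ 2) ^ k := by
    gcongr
    nlinarith [sq_nonneg (r - 1)]
  have h2 := Real.pow_div_factorial_le_exp (c / 2 * (1 + r ^ 2)) (by positivity) k
  rw [div_le_iff₀ (by positivity)] at h2
  have h3 : (1 + r ^ 2) ^ k = (2 / c) ^ k * (c / 2 * (1 + r ^ 2)) ^ k := by
    rw [← mul_pow]; congr 1; field_simp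
  have h4 : r ^ k ≤ (2 / c) ^ k * (Real.exp (c / 2 * (1 + r ^ 2)) * k.factorial) := by
    refine h1.trans ?_
    rw [h3]
    gcongr
  calc r ^ k * Real.exp (-c * r ^ 2)
      ≤ (2 / c) ^ k * (Real.exp (c / 2 * (1 + r ^ 2)) * k.factorial)
        * Real.exp (-c * r ^ 2) := by gcongr
    _ = (2 / c) ^ k * k.factorial
        * (Real.exp (c / 2 * (1 + r ^ 2)) * Real.exp (-c * r ^ 2)) := by ring
    _ = (2 / c) ^ k * k.factorial * (Real.exp (c / 2) * Real.exp (-(c / 2) * r ^ 2)) := by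
        rw [← Real.exp_add, ← Real.exp_add]; ring_nf
    _ = _ := by ring

theorem ae_ne_zero (n : ℕ) : ∀ᵐ x : E n, x ≠ 0 :=
  compl_mem_ae_iff.2 (measure_singleton (0 : E n))

theorem integrable_mul_exp_neg {n k : ℕ} {φ g : E n → ℝ} {c C : ℝ} (hc : 0 < c)
    (hφ : AEStronglyMeasurable φ) (hg : AEStronglyMeasurable g)
    (hφc : ∀ x, x ≠ 0 → c * ‖x‖ ^ 2 ≤ φ x) (hgC : ∀ x, x ≠ 0 → |g x| ≤ C * ‖x‖ ^ k) :
    Integrable fun x => g x * Real.exp (-φ x) := by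
  obtain ⟨K, hK, hb⟩ := exists_pow_mul_exp_neg_le k hc
  refine Integrable.mono' ((integrable_exp_neg_mul_norm_sq (half_pos hc)).const_mul (|C| * K))
    (hg.mul (Real.continuous_exp.comp_aestronglyMeasurable hφ.neg)) ?_
  filter_upwards [ae_ne_zero n] with x hx
  rw [norm_mul, Real.norm_eq_abs, Real.norm_of_nonneg (Real.exp_pos _).le]
  calc |g x| * Real.exp (-φ x) ≤ (|C| * ‖x‖ ^ k) * Real.exp (-c * ‖x‖ ^ 2) := by
        gcongr
        · exact (hgC x hx).trans (by gcongr; exact le_abs_self C)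
        · linarith [hφc x hx]
    _ = |C| * (‖x‖ ^ k * Real.exp (-c * ‖x‖ ^ 2)) := by ring
    _ ≤ |C| * (K * Real.exp (-(c / 2) * ‖x‖ ^ 2)) := mul_le_mul_of_nonneg_left (hb ‖x‖ (norm_nonneg x)) (abs_nonneg C)
    _ = _ := by ring

theorem aestronglyMeasurable_of_continuousOn_compl_zero {n : ℕ} {g : E n → ℝ}
    (hg : ContinuousOn g {0}ᶜ) : AEStronglyMeasurable g := by
  have := hg.aestronglyMeasurable (μ := volume) isOpen_compl_singleton.measurableSet
  rwa [Measure.restrict_eq_self_of_ae_mem (s := {0}ᶜ) (ae_ne_zero n)] at this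

/-- A positive function on `E n` which is homogeneous of degree two and smooth with positive
definite Hessian away from the origin: half the square of a smooth strongly convex support
function. -/
structure IsQuadraticGauge {n : ℕ} (ψ : E n → ℝ) : Prop where
  map_smul : ∀ (t : ℝ) (x : E n), 0 < t → ψ (t • x) = t ^ 2 * ψ x
  contDiffOn : ContDiffOn ℝ (⊤ : ℕ∞) ψ {0}ᶜ
  pos : ∀ x, x ≠ 0 → 0 < ψ x
  hess_pos : ∀ x, x ≠ 0 → ∀ v, v ≠ 0 → 0 < ⟪hess ψ x v, v⟫

theorem contDiffOn_gradient {n : ℕ} {ψ : E n → ℝ}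
    (h : ContDiffOn ℝ (⊤ : ℕ∞) ψ {0}ᶜ) : ContDiffOn ℝ (⊤ : ℕ∞) (gradient ψ) {0}ᶜ := by
  have h1 : ContDiffOn ℝ (⊤ : ℕ∞) (fderiv ℝ ψ) {0}ᶜ :=
    h.fderiv_of_isOpen isOpen_compl_singleton (by simp)
  exact (InnerProductSpace.toDual ℝ (E n)).symm.toContinuousLinearEquiv.contDiff.comp_contDiffOn h1

theorem hasFDerivAt_gradient {n : ℕ} {ψ : E n → ℝ}
    (h : ContDiffOn ℝ (⊤ : ℕ∞) ψ {0}ᶜ) {x : E n} (hx : x ≠ 0) :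
    HasFDerivAt (gradient ψ) (hess ψ x) x :=
  (((contDiffOn_gradient h).differentiableOn (by simp)).differentiableAt
    (isOpen_compl_singleton.mem_nhds hx)).hasFDerivAt

theorem hasGradientAt_of_contDiffOn {n : ℕ} {ψ : E n → ℝ}
    (h : ContDiffOn ℝ (⊤ : ℕ∞) ψ {0}ᶜ) {x : E n} (hx : x ≠ 0) :
    HasGradientAt ψ (gradient ψ x) x :=
  ((h.differentiableOn (by simp)).differentiableAt
    (isOpen_compl_singleton.mem_nhds hx)).hasGradientAt

theorem continuousOn_hess {n : ℕ} {ψ : E n → ℝ}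
    (h : ContDiffOn ℝ (⊤ : ℕ∞) ψ {0}ᶜ) : ContinuousOn (hess ψ) {0}ᶜ :=
  ((contDiffOn_gradient h).fderiv_of_isOpen (m := (⊤ : ℕ∞)) isOpen_compl_singleton
    (by simp)).continuousOn

/-- The Legendre transform. -/
def legendre {n : ℕ} (ψ : E n → ℝ) (x : E n) : ℝ := ⨆ y, (⟪x, y⟫ - ψ y)

theorem bddAbove_legendre {n : ℕ} {ψ : E n → ℝ} {c K : ℝ} (hc : 0 < c)
    (h : ∀ y, c * ‖y‖ ^ 2 - K ≤ ψ y) (x : E n) :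
    BddAbove (range fun y => ⟪x, y⟫ - ψ y) := by
  refine ⟨‖x‖ ^ 2 / (4 * c) + K, ?_⟩
  rintro _ ⟨y, rfl⟩
  have h1 := real_inner_le_norm x y
  have h2 : ‖x‖ * ‖y‖ - c * ‖y‖ ^ 2 ≤ ‖x‖ ^ 2 / (4 * c) := by
    rw [le_div_iff₀ (by positivity)]
    nlinarith [sq_nonneg (‖x‖ - 2 * c * ‖y‖)]
  simp only
  linarith [h y]

theorem measurable_legendre {n : ℕ} {ψ : E n → ℝ}
    (h : ∀ x : E n, BddAbove (range fun y => ⟪x, y⟫ - ψ y)) : Measurable (legendre ψ) := by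
  refine LowerSemicontinuous.measurable (lowerSemicontinuous_ciSup h fun y => ?_)
  exact Continuous.lowerSemicontinuous (by fun_prop)

namespace IsQuadraticGauge

variable {n : ℕ} {ψ : E n → ℝ}

theorem map_zero (h : IsQuadraticGauge ψ) : ψ 0 = 0 := by
  have := h.map_smul 2 0 (by norm_num)
  rw [smul_zero] at this
  linarith

theorem exists_lower_bound (h : IsQuadraticGauge ψ) : ∃ c, 0 < c ∧ ∀ x, c * ‖x‖ ^ 2 ≤ ψ x := by
  obtain ⟨c, hc, hb⟩ := exists_pos_lower_bound_of_homogeneous h.contDiffOn.continuousOn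
    (fun t x ht _ => h.map_smul t x ht) h.pos
  refine ⟨c, hc, fun x => ?_⟩
  by_cases hx : x = 0
  · simp [hx, h.map_zero]
  · exact hb x hx

theorem exists_upper_bound (h : IsQuadraticGauge ψ) : ∃ C, 0 < C ∧ ∀ x, ψ x ≤ C * ‖x‖ ^ 2 := by
  obtain ⟨C, hC, hb⟩ := exists_bound_of_homogeneous h.contDiffOn.continuousOn
    (fun t x ht _ => h.map_smul t x ht)
  refine ⟨C + 1, by positivity, fun x => ?_⟩
  by_cases hx : x = 0
  · simp [hx, h.map_zero]
  · nlinarith [(le_abs_self _).trans (hb x hx), sq_nonneg ‖x‖]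

theorem nonneg (h : IsQuadraticGauge ψ) (x : E n) : 0 ≤ ψ x := by
  by_cases hx : x = 0
  · simp [hx, h.map_zero]
  · exact (h.pos x hx).le

theorem continuous (h : IsQuadraticGauge ψ) : Continuous ψ := by
  rw [continuous_iff_continuousAt]
  intro x
  by_cases hx : x = 0
  · obtain ⟨C, hC, hb⟩ := h.exists_upper_bound
    subst hx
    rw [ContinuousAt, h.map_zero]
    refine squeeze_zero h.nonneg hb ?_
    have : Continuous fun x : E n => C * ‖x‖ ^ 2 := by fun_prop
    simpa using this.tendsto 0
  · exact h.contDiffOn.continuousOn.continuousAt (isOpen_compl_singleton.mem_nhds hx)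

theorem inner_gradient_self (h : IsQuadraticGauge ψ) {x : E n} (hx : x ≠ 0) :
    ⟪gradient ψ x, x⟫ = 2 * ψ x := by
  have h1 : HasDerivAt (fun t : ℝ => ψ (t • x)) ⟪gradient ψ x, x⟫ 1 := by
    have hg := (hasGradientAt_of_contDiffOn h.contDiffOn hx).hasFDerivAt
    have := HasFDerivAt.comp_hasDerivAt (f := fun t : ℝ => t • x) (l := ψ) 1
      (by simpa using hg) ((hasDerivAt_id (1 : ℝ)).smul_const x)
    simpa [Function.comp_def] using this
  have h2 : HasDerivAt (fun t : ℝ => ψ (t • x)) (2 * ψ x) 1 := by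
    have h3 : HasDerivAt (fun t : ℝ => t ^ 2 * ψ x) (2 * ψ x) 1 := by
      simpa using (hasDerivAt_pow 2 (1 : ℝ)).mul_const (ψ x)
    refine h3.congr_of_eventuallyEq ?_
    filter_upwards [lt_mem_nhds (zero_lt_one' ℝ)] with t ht
    exact h.map_smul t x ht
  exact h1.unique h2

theorem gradient_ne_zero (h : IsQuadraticGauge ψ) {x : E n} (hx : x ≠ 0) :
    gradient ψ x ≠ 0 := by
  intro h0
  have := h.inner_gradient_self hx
  rw [h0, inner_zero_left] at this
  linarith [h.pos x hx]

theorem injOn_gradient (h : IsQuadraticGauge ψ) : InjOn (gradient ψ) {0}ᶜ := by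
  intro a ha b hb hab
  by_contra hne
  by_cases h0 : ∃ t ∈ Icc (0 : ℝ) 1, a + t • (b - a) = 0
  · obtain ⟨t, ht, h0⟩ := h0
    have h1 := congrArg (fun v => ⟪gradient ψ a, v⟫) h0
    simp only [inner_add_right, inner_smul_right, inner_sub_right, inner_zero_right] at h1
    rw [h.inner_gradient_self ha, hab, h.inner_gradient_self hb] at h1
    have h2 := h.pos a ha
    have h3 := h.pos b hb
    rcases eq_or_lt_of_le ht.1 with h4 | h4
    · subst h4; linarith
    · nlinarith [mul_pos h4 h3, mul_nonneg (sub_nonneg.2 ht.2) h2.le]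
  · push Not at h0
    have hder : ∀ t ∈ Icc (0 : ℝ) 1, HasDerivAt
        (fun t : ℝ => ⟪gradient ψ (a + t • (b - a)), b - a⟫)
        ⟪hess ψ (a + t • (b - a)) (b - a), b - a⟫ t := by
      intro t ht
      have h1 := hasFDerivAt_gradient h.contDiffOn (h0 t ht)
      have h2 : HasDerivAt (fun t : ℝ => a + t • (b - a)) (b - a) t := by
        simpa using ((hasDerivAt_id t).smul_const (b - a)).const_add a
      have h3 := (h1.comp_hasDerivAt t h2).inner ℝ (hasDerivAt_const t (b - a))
      simpa using h3
    have hmono : StrictMonoOn (fun t : ℝ => ⟪gradient ψ (a + t • (b - a)), b - a⟫)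
        (Icc 0 1) := by
      refine strictMonoOn_of_deriv_pos (convex_Icc 0 1)
        (fun t ht => (hder t ht).continuousAt.continuousWithinAt) fun t ht => ?_
      rw [(hder t (interior_subset ht)).deriv]
      exact h.hess_pos _ (h0 t (interior_subset ht)) _ (sub_ne_zero.2 (Ne.symm hne))
    have := hmono (left_mem_Icc.2 zero_le_one) (right_mem_Icc.2 zero_le_one) zero_lt_one
    simp [hab] at this

theorem bddAbove (h : IsQuadraticGauge ψ) (x : E n) : BddAbove (range fun y => ⟪x, y⟫ - ψ y) := by
  obtain ⟨c, hc, hb⟩ := h.exists_lower_bound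
  exact bddAbove_legendre (K := 0) hc (by simpa using hb) x

theorem le_legendre (h : IsQuadraticGauge ψ) (x y : E n) : ⟪x, y⟫ - ψ y ≤ legendre ψ x :=
  le_ciSup (h.bddAbove x) y

theorem exists_legendre_eq (h : IsQuadraticGauge ψ) {x : E n} (hx : x ≠ 0) :
    ∃ y, y ≠ 0 ∧ gradient ψ y = x ∧ legendre ψ x = ⟪x, y⟫ - ψ y := by
  obtain ⟨c, hc, hb⟩ := h.exists_lower_bound
  have hcont : Continuous fun y => ⟪x, y⟫ - ψ y := by
    have := h.continuous
    fun_prop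
  obtain ⟨y, hy⟩ := hcont.exists_forall_ge' 0 (by
    filter_upwards [(tendsto_norm_cocompact_atTop (E := E n)).eventually_ge_atTop (‖x‖ / c)]
      with y hy
    rw [div_le_iff₀ hc] at hy
    rw [inner_zero_right, h.map_zero, sub_zero]
    have h1 := real_inner_le_norm x y
    nlinarith [hb y, norm_nonneg y])
  have hy0 : y ≠ 0 := by
    intro h0
    have h1 := hy ((‖x‖ ^ 2 / (2 * ψ x)) • x)
    have hψ := h.pos x hx
    have hx' : 0 < ‖x‖ := norm_pos_iff.2 hx
    rw [h0, inner_zero_right, h.map_zero, sub_zero, h.map_smul _ _ (by positivity),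
      inner_smul_right, real_inner_self_eq_norm_sq] at h1
    have : ‖x‖ ^ 2 / (2 * ψ x) * ‖x‖ ^ 2 - (‖x‖ ^ 2 / (2 * ψ x)) ^ 2 * ψ x
        = ‖x‖ ^ 4 / (4 * ψ x) := by field_simp; ring
    rw [this] at h1
    have : 0 < ‖x‖ ^ 4 / (4 * ψ x) := by positivity
    linarith
  refine ⟨y, hy0, ?_, le_antisymm (ciSup_le hy) (h.le_legendre x y)⟩
  have hg := (hasGradientAt_of_contDiffOn h.contDiffOn hy0).hasFDerivAt
  have h2 : HasFDerivAt (fun y => ⟪x, y⟫ - ψ y)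
      (InnerProductSpace.toDual ℝ (E n) x - InnerProductSpace.toDual ℝ (E n) (gradient ψ y)) y :=
    HasFDerivAt.sub (InnerProductSpace.toDual ℝ (E n) x).hasFDerivAt hg
  have h3 := IsLocalMax.hasFDerivAt_eq_zero (Eventually.of_forall hy) h2
  exact ((InnerProductSpace.toDual ℝ (E n)).injective (sub_eq_zero.1 h3)).symm

theorem image_gradient (h : IsQuadraticGauge ψ) : gradient ψ '' {0}ᶜ = {0}ᶜ := by
  refine Subset.antisymm ?_ fun x hx => ?_
  · rintro _ ⟨y, hy, rfl⟩
    exact h.gradient_ne_zero hy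
  · obtain ⟨y, hy, hyx, -⟩ := h.exists_legendre_eq hx
    exact ⟨y, hy, hyx⟩

theorem legendre_gradient (h : IsQuadraticGauge ψ) {y : E n} (hy : y ≠ 0) :
    legendre ψ (gradient ψ y) = ψ y := by
  obtain ⟨z, hz, hzy, hL⟩ := h.exists_legendre_eq (h.gradient_ne_zero hy)
  have := h.injOn_gradient hz hy hzy
  rw [hL, this, h.inner_gradient_self hy]
  ring

theorem exists_legendre_lower_bound (h : IsQuadraticGauge ψ) :
    ∃ c, 0 < c ∧ ∀ x, c * ‖x‖ ^ 2 ≤ legendre ψ x := by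
  obtain ⟨C, hC, hb⟩ := h.exists_upper_bound
  refine ⟨1 / (4 * C), by positivity, fun x => ?_⟩
  have h1 := h.le_legendre x ((1 / (2 * C)) • x)
  rw [h.map_smul _ _ (by positivity), inner_smul_right, real_inner_self_eq_norm_sq] at h1
  refine le_trans ?_ h1
  have h2 : (1 / (2 * C)) ^ 2 * ψ x ≤ (1 / (2 * C)) ^ 2 * (C * ‖x‖ ^ 2) := by
    gcongr; exact hb x
  have h3 : (1 / (2 * C)) ^ 2 * (C * ‖x‖ ^ 2) = 1 / (4 * C) * ‖x‖ ^ 2 := by field_simp; ring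
  have h4 : 1 / (2 * C) * ‖x‖ ^ 2 = 2 * (1 / (4 * C) * ‖x‖ ^ 2) := by field_simp; ring
  linarith

theorem measurable_legendre (h : IsQuadraticGauge ψ) : Measurable (legendre ψ) :=
  _root_.measurable_legendre h.bddAbove

theorem integral_eq (h : IsQuadraticGauge ψ) (F : E n → ℝ) :
    ∫ x, F x = ∫ y, |(hess ψ y).det| * F (gradient ψ y) := by
  have h1 := integral_image_eq_integral_abs_det_fderiv_smul volume
    (isOpen_compl_singleton (x := (0 : E n))).measurableSet
    (fun x hx => (hasFDerivAt_gradient h.contDiffOn hx).hasFDerivWithinAt) h.injOn_gradient F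
  rw [h.image_gradient, Measure.restrict_eq_self_of_ae_mem (s := {0}ᶜ) (ae_ne_zero n)] at h1
  exact h1

theorem lintegral_eq (h : IsQuadraticGauge ψ) (F : E n → ℝ≥0∞) :
    ∫⁻ x, F x = ∫⁻ y, ENNReal.ofReal |(hess ψ y).det| * F (gradient ψ y) := by
  have h1 := lintegral_image_eq_lintegral_abs_det_fderiv_mul volume
    (isOpen_compl_singleton (x := (0 : E n))).measurableSet
    (fun x hx => (hasFDerivAt_gradient h.contDiffOn hx).hasFDerivWithinAt) h.injOn_gradient F
  rw [h.image_gradient, Measure.restrict_eq_self_of_ae_mem (s := {0}ᶜ) (ae_ne_zero n)] at h1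
  exact h1

end IsQuadraticGauge

namespace IsQuadraticGauge

variable {n : ℕ} {ψ : E n → ℝ}

theorem gradient_smul (h : IsQuadraticGauge ψ) (t : ℝ) (x : E n) (ht : 0 < t) (hx : x ≠ 0) :
    gradient ψ (t • x) = t • gradient ψ x := by
  have := fderiv_homogeneous (k := 1) (h.contDiffOn.differentiableOn (by simp))
    (fun t x ht _ => h.map_smul t x ht) t x ht hx
  rw [gradient, this, map_smulₛₗ]
  simp [gradient]

theorem hess_smul (h : IsQuadraticGauge ψ) (t : ℝ) (x : E n) (ht : 0 < t) (hx : x ≠ 0) :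
    hess ψ (t • x) = hess ψ x := by
  have := fderiv_homogeneous (k := 0) ((contDiffOn_gradient h.contDiffOn).differentiableOn
    (by simp)) (fun t x ht hx => by simpa using h.gradient_smul t x ht hx) t x ht hx
  simpa [hess] using this

theorem continuousOn_det (h : IsQuadraticGauge ψ) :
    ContinuousOn (fun y => |(hess ψ y).det|) {0}ᶜ :=
  continuous_abs.comp_continuousOn
    (ContinuousLinearMap.continuous_det.comp_continuousOn (continuousOn_hess h.contDiffOn))

theorem exists_det_bound (h : IsQuadraticGauge ψ) :
    ∃ C, 0 ≤ C ∧ ∀ x, x ≠ 0 → |(hess ψ x).det| ≤ C := by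
  obtain ⟨C, hC, hb⟩ := exists_bound_of_homogeneous (k := 0) h.continuousOn_det
    (fun t x ht hx => by rw [h.hess_smul t x ht hx]; simp)
  exact ⟨C, hC, fun x hx => by simpa using hb x hx⟩

theorem exists_hess_bound (h : IsQuadraticGauge ψ) (e : E n) :
    ∃ C, 0 ≤ C ∧ ∀ x, x ≠ 0 → |⟪hess ψ x e, e⟫| ≤ C := by
  obtain ⟨C, hC, hb⟩ := exists_bound_of_homogeneous (k := 0) (g := fun x => ⟪hess ψ x e, e⟫)
    (((continuousOn_hess h.contDiffOn).clm_apply continuousOn_const).inner continuousOn_const)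
    (fun t x ht hx => by rw [h.hess_smul t x ht hx]; simp)
  exact ⟨C, hC, fun x hx => by simpa using hb x hx⟩

theorem exists_gradient_bound (h : IsQuadraticGauge ψ) (e : E n) :
    ∃ C, 0 ≤ C ∧ ∀ x, x ≠ 0 → |⟪gradient ψ x, e⟫| ≤ C * ‖x‖ := by
  obtain ⟨C, hC, hb⟩ := exists_bound_of_homogeneous (k := 1) (g := fun x => ⟪gradient ψ x, e⟫)
    ((contDiffOn_gradient h.contDiffOn).continuousOn.inner continuousOn_const)
    (fun t x ht hx => by rw [h.gradient_smul t x ht hx, inner_smul_left]; simp)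
  exact ⟨C, hC, fun x hx => by simpa using hb x hx⟩

theorem integrable_mul_exp_neg (h : IsQuadraticGauge ψ) {k : ℕ} {g : E n → ℝ} {C : ℝ}
    (hg : ContinuousOn g {0}ᶜ) (hC : ∀ x, x ≠ 0 → |g x| ≤ C * ‖x‖ ^ k) :
    Integrable fun x => g x * Real.exp (-ψ x) := by
  obtain ⟨c, hc, hb⟩ := h.exists_lower_bound
  exact _root_.integrable_mul_exp_neg hc h.continuous.aestronglyMeasurable
    (aestronglyMeasurable_of_continuousOn_compl_zero hg) (fun x _ => hb x) hC

theorem integrable_mul_exp_neg_legendre (h : IsQuadraticGauge ψ) {k : ℕ} {g : E n → ℝ} {C : ℝ}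
    (hg : Continuous g) (hC : ∀ x, |g x| ≤ C * ‖x‖ ^ k) :
    Integrable fun x => g x * Real.exp (-legendre ψ x) := by
  obtain ⟨c, hc, hb⟩ := h.exists_legendre_lower_bound
  exact _root_.integrable_mul_exp_neg hc h.measurable_legendre.aestronglyMeasurable
    hg.aestronglyMeasurable (fun x _ => hb x) (fun x _ => hC x)

end IsQuadraticGauge

theorem ae_forall_add_smul_ne_zero {n : ℕ} (hn : 1 ≤ n) (e : E n) :
    ∀ᵐ y : E n, ∀ t : ℝ, y + t • e ≠ 0 := by
  have hne : Submodule.span ℝ {e} ≠ ⊤ := by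
    intro h
    have h1 := finrank_span_le_card (R := ℝ) ({e} : Set (E n))
    rw [h, finrank_top, finrank_euclideanSpace, Fintype.card_fin, Set.toFinset_singleton,
      Finset.card_singleton] at h1
    omega
  have h0 := Measure.addHaar_submodule (volume : Measure (E n)) _ hne
  filter_upwards [compl_mem_ae_iff.2 h0] with y hy t ht
  refine hy (Submodule.mem_span_singleton.2 ⟨-t, ?_⟩)
  rw [neg_smul]
  exact (eq_neg_of_add_eq_zero_left ht).symm

theorem hasDerivAt_comp_add_smul {n : ℕ} {F : Type*} [NormedAddCommGroup F] [NormedSpace ℝ F]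
    {g : E n → F} {y e : E n} {t : ℝ} {g' : E n →L[ℝ] F}
    (hg : HasFDerivAt g g' (y + t • e)) :
    HasDerivAt (fun s : ℝ => g (y + s • e)) (g' e) t := by
  have h2 : HasDerivAt (fun t : ℝ => y + t • e) e t := by
    simpa using ((hasDerivAt_id t).smul_const e).const_add y
  exact hg.comp_hasDerivAt t h2

/-- The symmetric second difference of `ψ` in direction `e`. -/
def secondDiff {n : ℕ} (ψ : E n → ℝ) (e : E n) (t : ℝ) (y : E n) : ℝ :=
  ψ (y + t • e) + ψ (y - t • e) - 2 * ψ y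

namespace IsQuadraticGauge

variable {n : ℕ} {ψ : E n → ℝ}

theorem hasDerivAt_comp_line (h : IsQuadraticGauge ψ) {y e : E n} {t : ℝ}
    (hy : y + t • e ≠ 0) :
    HasDerivAt (fun s : ℝ => ψ (y + s • e)) ⟪gradient ψ (y + t • e), e⟫ t :=
  hasDerivAt_comp_add_smul (hasGradientAt_of_contDiffOn h.contDiffOn hy).hasFDerivAt

theorem hasDerivAt_gradient_comp_line (h : IsQuadraticGauge ψ) {y e : E n} {t : ℝ}
    (hy : y + t • e ≠ 0) :
    HasDerivAt (fun s : ℝ => ⟪gradient ψ (y + s • e), e⟫) ⟪hess ψ (y + t • e) e, e⟫ t := by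
  simpa using (hasDerivAt_comp_add_smul (hasFDerivAt_gradient h.contDiffOn hy)).inner ℝ
    (hasDerivAt_const t e)

theorem hasDerivAt_secondDiff (h : IsQuadraticGauge ψ) {y e : E n}
    (hy : ∀ t : ℝ, y + t • e ≠ 0) (t : ℝ) :
    HasDerivAt (fun t => secondDiff ψ e t y)
      (⟪gradient ψ (y + t • e), e⟫ - ⟪gradient ψ (y + (-t) • e), e⟫) t := by
  have h1 := h.hasDerivAt_comp_line (hy t)
  have h2 := (h.hasDerivAt_comp_line (hy (-t))).comp t (hasDerivAt_neg t)
  have := (h1.add h2).sub_const (2 * ψ y)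
  simpa [secondDiff, Function.comp_def, sub_eq_add_neg] using this

theorem hasDerivAt_deriv_secondDiff (h : IsQuadraticGauge ψ) {y e : E n}
    (hy : ∀ t : ℝ, y + t • e ≠ 0) (t : ℝ) :
    HasDerivAt (fun t : ℝ => ⟪gradient ψ (y + t • e), e⟫ - ⟪gradient ψ (y + (-t) • e), e⟫)
      (⟪hess ψ (y + t • e) e, e⟫ + ⟪hess ψ (y + (-t) • e) e, e⟫) t := by
  have h1 := h.hasDerivAt_gradient_comp_line (hy t)
  have h2 := (h.hasDerivAt_gradient_comp_line (hy (-t))).comp t (hasDerivAt_neg t)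
  have := h1.fun_sub h2
  simpa [Function.comp_def] using this

theorem abs_secondDiff_le (h : IsQuadraticGauge ψ) {e : E n} {C : ℝ}
    (hC : ∀ x, x ≠ 0 → |⟪hess ψ x e, e⟫| ≤ C) {y : E n}
    (hy : ∀ t : ℝ, y + t • e ≠ 0) {t : ℝ} (ht : 0 ≤ t) :
    |secondDiff ψ e t y| ≤ 2 * C * t ^ 2 := by
  have h1 : ∀ s ∈ Icc 0 t,
      ‖⟪gradient ψ (y + s • e), e⟫ - ⟪gradient ψ (y + (-s) • e), e⟫‖ ≤ 2 * C * t := by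
    intro s hs
    have := (convex_Icc 0 t).norm_image_sub_le_of_norm_hasDerivWithin_le (C := 2 * C)
      (fun r _ => (h.hasDerivAt_deriv_secondDiff hy r).hasDerivWithinAt) (fun r _ => ?_)
      (left_mem_Icc.2 ht) hs
    · simp only [neg_zero, sub_self, sub_zero] at this
      refine this.trans ?_
      have hC0 : 0 ≤ C := (abs_nonneg _).trans (hC _ (hy 0))
      rw [Real.norm_of_nonneg hs.1]
      gcongr
      exact hs.2
    · refine (norm_add_le _ _).trans ?_
      have := hC _ (hy r)
      have := hC _ (hy (-r))
      simp only [Real.norm_eq_abs]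
      linarith
  have := (convex_Icc 0 t).norm_image_sub_le_of_norm_hasDerivWithin_le
    (fun r _ => (h.hasDerivAt_secondDiff hy r).hasDerivWithinAt) h1
    (left_mem_Icc.2 ht) (right_mem_Icc.2 ht)
  have h0 : secondDiff ψ e 0 y = 0 := by simp [secondDiff]; ring
  rw [h0, sub_zero, sub_zero, Real.norm_eq_abs, Real.norm_of_nonneg ht] at this
  exact this.trans_eq (by ring)

theorem tendsto_secondDiff (h : IsQuadraticGauge ψ) {y e : E n}
    (hy : ∀ t : ℝ, y + t • e ≠ 0) :
    Tendsto (fun t => secondDiff ψ e t y / t ^ 2) (𝓝[>] 0) (𝓝 ⟪hess ψ y e, e⟫) := by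
  have h0 : secondDiff ψ e 0 y = 0 := by simp [secondDiff]; ring
  refine HasDerivAt.lhopital_zero_nhdsGT (f' := fun t : ℝ =>
      ⟪gradient ψ (y + t • e), e⟫ - ⟪gradient ψ (y + (-t) • e), e⟫) (g' := fun t => 2 * t)
    (Eventually.of_forall fun t => h.hasDerivAt_secondDiff hy t)
    (Eventually.of_forall fun t => by simpa using hasDerivAt_pow 2 t) ?_ ?_ ?_ ?_
  · filter_upwards [self_mem_nhdsWithin] with t ht
    exact (mul_pos two_pos ht).ne'
  · have := (h.hasDerivAt_secondDiff hy 0).continuousAt.tendsto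
    rw [h0] at this
    exact this.mono_left nhdsWithin_le_nhds
  · have : Continuous fun t : ℝ => t ^ 2 := by fun_prop
    exact (by simpa using this.tendsto 0 : Tendsto (fun t : ℝ => t ^ 2) (𝓝 0) (𝓝 0)).mono_left
      nhdsWithin_le_nhds
  · have := (h.hasDerivAt_deriv_secondDiff hy 0).tendsto_slope
    have h2 := (this.mono_left (nhdsWithin_mono 0 (fun t (ht : 0 < t) => ht.ne'))).div_const 2
    simp only [neg_zero, zero_smul, add_zero, ← two_mul] at h2
    rw [mul_div_cancel_left₀ _ (two_ne_zero' ℝ)] at h2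
    refine h2.congr fun t => ?_
    simp [slope_def_field]
    ring

theorem continuous_secondDiff (h : IsQuadraticGauge ψ) (e : E n) (t : ℝ) :
    Continuous (secondDiff ψ e t) := by
  have := h.continuous
  unfold secondDiff
  fun_prop

theorem tendsto_integral_secondDiff (h : IsQuadraticGauge ψ) (hn : 1 ≤ n) (e : E n) :
    Tendsto (fun t => ∫ y, secondDiff ψ e t y / t ^ 2 * (|(hess ψ y).det| * Real.exp (-ψ y)))
      (𝓝[>] 0) (𝓝 (∫ y, ⟪hess ψ y e, e⟫ * (|(hess ψ y).det| * Real.exp (-ψ y)))) := by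
  obtain ⟨C, hC0, hC⟩ := h.exists_hess_bound e
  obtain ⟨M, hM0, hM⟩ := h.exists_det_bound
  have hw := h.integrable_mul_exp_neg (k := 0) h.continuousOn_det (by simpa using hM)
  refine tendsto_integral_filter_of_dominated_convergence
    (fun y => 2 * C * (|(hess ψ y).det| * Real.exp (-ψ y))) ?_ ?_ (hw.const_mul _) ?_
  · refine Eventually.of_forall fun t => ?_
    exact ((h.continuous_secondDiff e t).div_const (t ^ 2)).aestronglyMeasurable.mul
      hw.aestronglyMeasurable
  · filter_upwards [self_mem_nhdsWithin] with t ht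
    filter_upwards [ae_forall_add_smul_ne_zero hn e] with y hy
    have ht' : (0 : ℝ) < t := ht
    rw [norm_mul, Real.norm_of_nonneg (by positivity : 0 ≤ |(hess ψ y).det| * Real.exp (-ψ y)),
      norm_div, Real.norm_of_nonneg (by positivity : 0 ≤ t ^ 2)]
    gcongr
    rw [div_le_iff₀ (by positivity)]
    exact h.abs_secondDiff_le hC hy ht'.le
  · filter_upwards [ae_forall_add_smul_ne_zero hn e] with y hy
    exact (h.tendsto_secondDiff hy).mul_const _

end IsQuadraticGauge

theorem one_add_add_sub_le_exp (u : ℝ) : 1 + u + u ^ 2 / 2 - |u| ^ 3 ≤ Real.exp u := by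
  rcases le_total |u| 1 with h | h
  · have h1 := Real.exp_bound h (n := 3) (by norm_num)
    norm_num [Finset.sum_range_succ, Nat.factorial] at h1
    have h2 := (abs_le.1 h1).1
    nlinarith [pow_nonneg (abs_nonneg u) 3]
  · rcases le_total 0 u with h0 | h0
    · have := Real.quadratic_le_exp_of_nonneg h0
      have : 0 ≤ |u| ^ 3 := by positivity
      linarith
    · rw [abs_of_nonpos h0] at h ⊢
      have := Real.exp_pos u
      nlinarith [sq_nonneg u, mul_nonneg (sub_nonneg.2 h) (sq_nonneg u)]

theorem ofReal_integral_le_lintegral_ofReal {α : Type*} [MeasurableSpace α] {μ : Measure α}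
    {g : α → ℝ} (hg : Integrable g μ) :
    ENNReal.ofReal (∫ x, g x ∂μ) ≤ ∫⁻ x, ENNReal.ofReal (g x) ∂μ := by
  have h1 : ∫ x, g x ∂μ ≤ ∫ x, max (g x) 0 ∂μ :=
    integral_mono hg hg.pos_part fun x => le_max_left _ _
  refine (ENNReal.ofReal_le_ofReal h1).trans ?_
  rw [ofReal_integral_eq_lintegral_ofReal hg.pos_part (Eventually.of_forall fun x =>
    le_max_right _ _)]
  exact lintegral_mono fun x => by simp

namespace IsQuadraticGauge

variable {n : ℕ} {ψ : E n → ℝ}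

theorem integrable_inner_pow_mul_exp (h : IsQuadraticGauge ψ) (e : E n) (k : ℕ) :
    Integrable fun x => ⟪x, e⟫ ^ k * Real.exp (-legendre ψ x) := by
  refine h.integrable_mul_exp_neg_legendre (k := k) (C := ‖e‖ ^ k) (by fun_prop) fun x => ?_
  rw [abs_pow, ← mul_pow, mul_comm ‖e‖]
  gcongr
  exact abs_real_inner_le_norm x e

theorem ofReal_le_lintegral_exp_legendre_add (h : IsQuadraticGauge ψ) (e : E n)
    (hcent : ∫ x, ⟪x, e⟫ * Real.exp (-legendre ψ x) = 0) (s : ℝ) :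
    ENNReal.ofReal ((∫ x, Real.exp (-legendre ψ x))
        + s ^ 2 / 2 * (∫ x, ⟪x, e⟫ ^ 2 * Real.exp (-legendre ψ x))
        - |s| ^ 3 * ∫ x, |⟪x, e⟫ ^ 3 * Real.exp (-legendre ψ x)|)
      ≤ ∫⁻ x, ENNReal.ofReal (Real.exp (-legendre ψ x + s * ⟪x, e⟫)) := by
  have i0 : Integrable fun x => Real.exp (-legendre ψ x) := by
    simpa using h.integrable_inner_pow_mul_exp e 0
  have i1 : Integrable fun x => ⟪x, e⟫ * Real.exp (-legendre ψ x) := by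
    simpa using h.integrable_inner_pow_mul_exp e 1
  have i2 := h.integrable_inner_pow_mul_exp e 2
  have i3 := (h.integrable_inner_pow_mul_exp e 3).abs
  have hsum : ∫ x, (Real.exp (-legendre ψ x) + s * (⟪x, e⟫ * Real.exp (-legendre ψ x))
        + s ^ 2 / 2 * (⟪x, e⟫ ^ 2 * Real.exp (-legendre ψ x))
        - |s| ^ 3 * |⟪x, e⟫ ^ 3 * Real.exp (-legendre ψ x)|)
      = (∫ x, Real.exp (-legendre ψ x))
        + s ^ 2 / 2 * (∫ x, ⟪x, e⟫ ^ 2 * Real.exp (-legendre ψ x))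
        - |s| ^ 3 * ∫ x, |⟪x, e⟫ ^ 3 * Real.exp (-legendre ψ x)| := by
    rw [integral_sub ((i0.fun_add (i1.const_mul s)).fun_add (i2.const_mul _)) (i3.const_mul _),
      integral_add (i0.fun_add (i1.const_mul s)) (i2.const_mul _),
      integral_add i0 (i1.const_mul s), integral_const_mul, integral_const_mul,
      integral_const_mul, hcent, mul_zero, add_zero]
  rw [← hsum]
  refine (ofReal_integral_le_lintegral_ofReal (((i0.fun_add (i1.const_mul s)).fun_add
    (i2.const_mul _)).sub (i3.const_mul _))).trans (lintegral_mono fun x => ?_)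
  refine ENNReal.ofReal_le_ofReal ?_
  have h1 := one_add_add_sub_le_exp (s * ⟪x, e⟫)
  have h2 := mul_le_mul_of_nonneg_right h1 (Real.exp_pos (-legendre ψ x)).le
  rw [add_comm (-legendre ψ x), Real.exp_add]
  refine le_trans (le_of_eq ?_) h2
  simp only [Pi.sub_apply, abs_mul, abs_pow, abs_of_pos (Real.exp_pos _)]
  ring

/-- The average of the translates of `ψ` by `± t • e`. -/
def _root_.translateAvg {n : ℕ} (ψ : E n → ℝ) (e : E n) (t : ℝ) (y : E n) : ℝ :=
  (ψ (y + t • e) + ψ (y - t • e)) / 2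

theorem bddAbove_translateAvg (h : IsQuadraticGauge ψ) (e : E n) (t : ℝ) (x : E n) :
    BddAbove (range fun y => ⟪x, y⟫ - translateAvg ψ e t y) := by
  obtain ⟨c, hc, hb⟩ := h.exists_lower_bound
  refine bddAbove_legendre (K := 0) hc (fun y => ?_) x
  have h1 := hb (y + t • e)
  have h2 := hb (y - t • e)
  have h3 := parallelogram_law_with_norm ℝ y (t • e)
  have h4 : 0 ≤ c * (‖t • e‖ * ‖t • e‖) := by positivity
  have h5 := congrArg (fun r => c * r) h3
  simp only [translateAvg]
  linarith

theorem lintegral_exp_mul_le (h : IsQuadraticGauge ψ) (e : E n) (t : ℝ) :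
    (∫⁻ x, ENNReal.ofReal (Real.exp (-legendre ψ x + t * ⟪x, e⟫)))
      * (∫⁻ x, ENNReal.ofReal (Real.exp (-legendre ψ x + (-t) * ⟪x, e⟫)))
      ≤ (∫⁻ x, ENNReal.ofReal (Real.exp (-legendre (translateAvg ψ e t) x))) ^ 2 := by
  have hm := h.measurable_legendre
  have hm' := _root_.measurable_legendre (h.bddAbove_translateAvg e t)
  refine prekopa_leindler (by fun_prop) (by fun_prop) (by fun_prop) fun x y => ?_
  rw [← ENNReal.ofReal_mul (Real.exp_pos _).le, ← ENNReal.ofReal_pow (Real.exp_pos _).le,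
    ← Real.exp_add, ← Real.exp_nat_mul]
  refine ENNReal.ofReal_le_ofReal (Real.exp_le_exp.2 ?_)
  have key : legendre (translateAvg ψ e t) ((1 / 2 : ℝ) • (x + y))
      ≤ (legendre ψ x + legendre ψ y - t * ⟪x, e⟫ + t * ⟪y, e⟫) / 2 := by
    refine ciSup_le fun z => ?_
    have h1 := h.le_legendre x (z + t • e)
    have h2 := h.le_legendre y (z - t • e)
    simp only [inner_add_right, inner_sub_right, inner_smul_right] at h1 h2
    simp only [translateAvg, inner_smul_left, inner_add_left]
    norm_num
    linarith
  push_cast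
  linarith

theorem integral_exp_legendre (h : IsQuadraticGauge ψ) (F : E n → ℝ) :
    ∫ x, F x * Real.exp (-legendre ψ x)
      = ∫ y, F (gradient ψ y) * (|(hess ψ y).det| * Real.exp (-ψ y)) := by
  rw [h.integral_eq]
  refine integral_congr_ae ?_
  filter_upwards [ae_ne_zero n] with y hy
  rw [h.legendre_gradient hy]
  ring

theorem lintegral_exp_legendre_translateAvg_le (h : IsQuadraticGauge ψ) (hn : 1 ≤ n) (e : E n)
    {C : ℝ} (hC : ∀ x, x ≠ 0 → |⟪hess ψ x e, e⟫| ≤ C) {t : ℝ} (ht : 0 < t)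
    (hCt : C * t ^ 2 ≤ 1) :
      0 ≤ (∫ x, Real.exp (-legendre ψ x))
        + t ^ 2 / 2 * (∫ y, secondDiff ψ e t y / t ^ 2 *
          (|(hess ψ y).det| * Real.exp (-ψ y)))
        + (C * t ^ 2) ^ 2 * ∫ x, Real.exp (-legendre ψ x) ∧
      ∫⁻ x, ENNReal.ofReal (Real.exp (-legendre (translateAvg ψ e t) x))
        ≤ ENNReal.ofReal ((∫ x, Real.exp (-legendre ψ x))
        + t ^ 2 / 2 * (∫ y, secondDiff ψ e t y / t ^ 2 *
          (|(hess ψ y).det| * Real.exp (-ψ y)))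
        + (C * t ^ 2) ^ 2 * ∫ x, Real.exp (-legendre ψ x)) := by
  obtain ⟨M, hM0, hM⟩ := h.exists_det_bound
  have hw := h.integrable_mul_exp_neg (k := 0) h.continuousOn_det (by simpa using hM)
  have hS : ∀ᵐ y, |secondDiff ψ e t y / 2| ≤ C * t ^ 2 := by
    filter_upwards [ae_forall_add_smul_ne_zero hn e] with y hy
    have := h.abs_secondDiff_le hC hy ht.le
    rw [abs_div, abs_two]
    linarith
  have hSw : Integrable fun y => secondDiff ψ e t y / t ^ 2 *
      (|(hess ψ y).det| * Real.exp (-ψ y)) := by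
    refine Integrable.bdd_mul (c := 2 * C) hw
      ((h.continuous_secondDiff e t).div_const (t ^ 2)).aestronglyMeasurable ?_
    filter_upwards [hS] with y hy
    rw [norm_div, Real.norm_of_nonneg (by positivity : 0 ≤ t ^ 2), div_le_iff₀ (by positivity)]
    rw [abs_div, abs_two] at hy
    rw [Real.norm_eq_abs]
    linarith
  have hZ : ∫ x, Real.exp (-legendre ψ x) = ∫ y, |(hess ψ y).det| * Real.exp (-ψ y) := by
    simpa using h.integral_exp_legendre fun _ => 1
  have hsum : ∫ y, ((|(hess ψ y).det| * Real.exp (-ψ y)) + t ^ 2 / 2 *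
        (secondDiff ψ e t y / t ^ 2 * (|(hess ψ y).det| * Real.exp (-ψ y)))
        + (C * t ^ 2) ^ 2 * (|(hess ψ y).det| * Real.exp (-ψ y)))
      = (∫ x, Real.exp (-legendre ψ x))
        + t ^ 2 / 2 * (∫ y, secondDiff ψ e t y / t ^ 2 *
          (|(hess ψ y).det| * Real.exp (-ψ y)))
        + (C * t ^ 2) ^ 2 * ∫ x, Real.exp (-legendre ψ x) := by
    rw [integral_add (hw.fun_add (hSw.const_mul _)) (hw.const_mul _),
      integral_add hw (hSw.const_mul _), integral_const_mul, integral_const_mul, hZ]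
  have hpt : ∀ᵐ y, |(hess ψ y).det| * Real.exp (-legendre (translateAvg ψ e t) (gradient ψ y))
      ≤ (|(hess ψ y).det| * Real.exp (-ψ y)) + t ^ 2 / 2 *
        (secondDiff ψ e t y / t ^ 2 * (|(hess ψ y).det| * Real.exp (-ψ y)))
        + (C * t ^ 2) ^ 2 * (|(hess ψ y).det| * Real.exp (-ψ y)) := by
    filter_upwards [hS, ae_ne_zero n] with y hy hy0
    have h1 : ⟪gradient ψ y, y⟫ - translateAvg ψ e t y
        ≤ legendre (translateAvg ψ e t) (gradient ψ y) :=
      le_ciSup (h.bddAbove_translateAvg e t (gradient ψ y)) y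
    rw [h.inner_gradient_self hy0] at h1
    have h2 := Real.abs_exp_sub_one_sub_id_le (hy.trans hCt)
    have h3 : Real.exp (secondDiff ψ e t y / 2)
        ≤ 1 + secondDiff ψ e t y / 2 + (C * t ^ 2) ^ 2 := by
      have h4 := (abs_le.1 h2).2
      have h5 : (secondDiff ψ e t y / 2) ^ 2 ≤ (C * t ^ 2) ^ 2 := by
        rw [← sq_abs (secondDiff ψ e t y / 2)]
        gcongr
      linarith
    have h6 : Real.exp (-legendre (translateAvg ψ e t) (gradient ψ y))
        ≤ Real.exp (-ψ y) * (1 + secondDiff ψ e t y / 2 + (C * t ^ 2) ^ 2) := by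
      refine le_trans ?_ (mul_le_mul_of_nonneg_left h3 (Real.exp_pos _).le)
      rw [← Real.exp_add, Real.exp_le_exp]
      simp only [secondDiff, translateAvg] at h1 ⊢
      linarith
    refine (mul_le_mul_of_nonneg_left h6 (abs_nonneg _)).trans_eq ?_
    field_simp
  have hnn := hpt.mono fun y hy => le_trans (by positivity) hy
  rw [h.lintegral_eq, ← hsum, ofReal_integral_eq_lintegral_ofReal
    ((hw.fun_add (hSw.const_mul _)).fun_add (hw.const_mul _)) hnn]
  refine ⟨integral_nonneg_of_ae hnn, lintegral_mono_ae ?_⟩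
  filter_upwards [hpt] with y hy
  rw [← ENNReal.ofReal_mul (abs_nonneg _)]
  exact ENNReal.ofReal_le_ofReal hy

/-- The Brascamp-Lieb variance inequality for linear functions, in the gradient coordinates. -/
theorem brascamp_lieb (h : IsQuadraticGauge ψ) (hn : 1 ≤ n) (e : E n)
    (hcent : ∫ x, ⟪x, e⟫ * Real.exp (-legendre ψ x) = 0) :
    ∫ y, ⟪gradient ψ y, e⟫ ^ 2 * (|(hess ψ y).det| * Real.exp (-ψ y))
      ≤ ∫ y, ⟪hess ψ y e, e⟫ * (|(hess ψ y).det| * Real.exp (-ψ y)) := by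
  obtain ⟨C, hC0, hC⟩ := h.exists_hess_bound e
  set Z := ∫ x, Real.exp (-legendre ψ x) with hZ
  rw [← h.integral_exp_legendre fun x => ⟪x, e⟫ ^ 2]
  set V := ∫ x, ⟪x, e⟫ ^ 2 * Real.exp (-legendre ψ x) with hV
  set W := ∫ x, |⟪x, e⟫ ^ 3 * Real.exp (-legendre ψ x)| with hW
  set A : ℝ → ℝ := fun t => ∫ y, secondDiff ψ e t y / t ^ 2 *
    (|(hess ψ y).det| * Real.exp (-ψ y)) with hA
  have hZ0 : 0 ≤ Z := integral_nonneg fun x => (Real.exp_pos _).le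
  have key : ∀ᶠ t in 𝓝[>] (0 : ℝ), V ≤ A t + 2 * C ^ 2 * t ^ 2 * Z + 2 * t * W := by
    have hsmall : ∀ᶠ t in 𝓝[>] (0 : ℝ), C * t ^ 2 ≤ 1 := by
      have hc : Continuous fun t : ℝ => C * t ^ 2 := by fun_prop
      have := (hc.tendsto 0).mono_left (nhdsWithin_le_nhds (s := Ioi 0))
      exact this.eventually (ge_mem_nhds (by norm_num))
    filter_upwards [hsmall, self_mem_nhdsWithin] with t hCt ht
    have ht' : 0 < t := ht
    have h1 := h.ofReal_le_lintegral_exp_legendre_add e hcent t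
    have h2 := h.ofReal_le_lintegral_exp_legendre_add e hcent (-t)
    rw [neg_sq, abs_neg] at h2
    obtain ⟨hR, h3⟩ := h.lintegral_exp_legendre_translateAvg_le hn e hC ht' hCt
    have h4 := (mul_le_mul' h1 h2).trans ((h.lintegral_exp_mul_le e t).trans
      (pow_le_pow_left' h3 2))
    rw [← sq, ENNReal.pow_le_pow_left_iff two_ne_zero] at h4
    simp only [← hZ, ← hV, ← hW] at h4
    have h5 : Z + t ^ 2 / 2 * V - |t| ^ 3 * W
        ≤ Z + t ^ 2 / 2 * A t + (C * t ^ 2) ^ 2 * Z := by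
      rcases ENNReal.ofReal_le_ofReal_iff'.1 h4 with h5 | h5
      · exact h5
      · exact h5.trans hR
    rw [abs_of_pos ht'] at h5
    have h6 : t ^ 2 / 2 * V ≤ t ^ 2 / 2 * (A t + 2 * C ^ 2 * t ^ 2 * Z + 2 * t * W) := by
      linarith
    exact le_of_mul_le_mul_left h6 (by positivity)
  have hlim : Tendsto (fun t => A t + 2 * C ^ 2 * t ^ 2 * Z + 2 * t * W) (𝓝[>] 0)
      (𝓝 (∫ y, ⟪hess ψ y e, e⟫ * (|(hess ψ y).det| * Real.exp (-ψ y)))) := by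
    have h1 := h.tendsto_integral_secondDiff hn e
    have hc : Continuous fun t : ℝ => 2 * C ^ 2 * t ^ 2 * Z + 2 * t * W := by fun_prop
    have h2 := (hc.tendsto 0).mono_left (nhdsWithin_le_nhds (s := Ioi 0))
    simpa [add_assoc] using h1.add h2
  exact ge_of_tendsto hlim key

end IsQuadraticGauge

theorem integral_hasFDerivAt_eq_zero {n : ℕ} (hn : 1 ≤ n) {V : E n → ℝ}
    {V' : E n → E n →L[ℝ] ℝ} {c K : ℝ} (hc : 0 < c) (hV : Integrable V)
    (hd : ∀ x, x ≠ 0 → HasFDerivAt V (V' x) x) (e : E n)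
    (hb : ∀ x, x ≠ 0 → |V' x e| ≤ K * Real.exp (-c * ‖x‖ ^ 2)) :
    ∫ x, V' x e = 0 := by
  have hK : 0 ≤ K := by
    have h1 : (EuclideanSpace.single 0 1 : E n) ≠ 0 := by simp
    have h2 := (abs_nonneg _).trans (hb _ h1)
    exact nonneg_of_mul_nonneg_left h2 (Real.exp_pos _)
  set B : E n → ℝ := fun y => K * (Real.exp (c * ‖e‖ ^ 2) * Real.exp (-(c / 2) * ‖y‖ ^ 2))
    with hB
  have hBi : Integrable B :=
    ((integrable_exp_neg_mul_norm_sq (half_pos hc)).const_mul _).const_mul _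
  have hzero : ∀ δ : ℝ, ∫ y, δ⁻¹ * (V (y + δ • e) - V y) = 0 := by
    intro δ
    rw [integral_const_mul, integral_sub (hV.comp_add_right (δ • e)) hV,
      integral_add_right_eq_self, sub_self, mul_zero]
  have hlim : Tendsto (fun δ : ℝ => ∫ y, δ⁻¹ * (V (y + δ • e) - V y)) (𝓝[>] 0)
      (𝓝 (∫ y, V' y e)) := by
    refine tendsto_integral_filter_of_dominated_convergence B ?_ ?_ hBi ?_
    · exact Eventually.of_forall fun δ =>
        (((hV.comp_add_right (δ • e)).sub hV).const_mul δ⁻¹).aestronglyMeasurable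
    · filter_upwards [Ioo_mem_nhdsGT (zero_lt_one' ℝ)] with δ hδ
      filter_upwards [ae_forall_add_smul_ne_zero hn e] with y hy
      have h1 := (convex_Icc 0 δ).norm_image_sub_le_of_norm_hasDerivWithin_le (C := B y)
        (f := fun s : ℝ => V (y + s • e))
        (fun s _ => (hasDerivAt_comp_add_smul (hd _ (hy s))).hasDerivWithinAt) (fun s hs => ?_)
        (left_mem_Icc.2 hδ.1.le) (right_mem_Icc.2 hδ.1.le)
      · simp only [zero_smul, add_zero, sub_zero] at h1
        rw [Real.norm_of_nonneg hδ.1.le] at h1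
        rw [norm_mul, norm_inv, Real.norm_of_nonneg hδ.1.le, inv_mul_le_iff₀ hδ.1]
        linarith
      · rw [Real.norm_eq_abs]
        refine (hb _ (hy s)).trans ?_
        simp only [hB]
        rw [← Real.exp_add]
        gcongr
        have h2 := norm_add_le (y + s • e) (-(s • e))
        rw [add_neg_cancel_right, norm_neg, norm_smul, Real.norm_of_nonneg hs.1] at h2
        have h3 : s * ‖e‖ ≤ ‖e‖ := by
          have := hs.2.trans hδ.2.le
          nlinarith [norm_nonneg e]
        have h4 : ‖y‖ ^ 2 ≤ (‖y + s • e‖ + ‖e‖) ^ 2 := by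
          gcongr
          linarith
        nlinarith [sq_nonneg (‖y + s • e‖ - ‖e‖)]
    · filter_upwards [ae_forall_add_smul_ne_zero hn e] with y hy
      have h1 := (hasDerivAt_comp_add_smul (hd _ (hy 0))).tendsto_slope_zero_right
      simpa using h1
  simp only [hzero] at hlim
  exact (tendsto_nhds_unique hlim tendsto_const_nhds)

theorem IsQuadraticGauge.integral_fderiv_sub_mul_exp {n : ℕ} {ψ U : E n → ℝ}
    (h : IsQuadraticGauge ψ) (hn : 1 ≤ n) (hU : ContDiffOn ℝ 1 U {0}ᶜ)
    (hUhom : ∀ (t : ℝ) (x : E n), 0 < t → x ≠ 0 → U (t • x) = t * U x) (e : E n) :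
    ∫ x, (fderiv ℝ U x e - U x * ⟪gradient ψ x, e⟫) * Real.exp (-ψ x) = 0 := by
  obtain ⟨c, hc, hψ⟩ := h.exists_lower_bound
  obtain ⟨C₀, hC₀, hU₀⟩ := exists_bound_of_homogeneous (k := 1) hU.continuousOn
    (by simpa using hUhom)
  have hUd : DifferentiableOn ℝ U {0}ᶜ := hU.differentiableOn (by simp)
  have hU'c : ContinuousOn (fderiv ℝ U) {0}ᶜ :=
    (hU.fderiv_of_isOpen (m := 0) isOpen_compl_singleton (by simp)).continuousOn
  obtain ⟨C₁, hC₁, hU₁⟩ := exists_bound_of_homogeneous (k := 0)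
    (hU'c.clm_apply (continuousOn_const (c := e))) (fun t x ht hx => by
      rw [fderiv_homogeneous (k := 0) hUd (by simpa using hUhom) t x ht hx]; simp)
  obtain ⟨C₂, hC₂, hψ₁⟩ := h.exists_gradient_bound e
  obtain ⟨K₀, hK₀, hexp₀⟩ := exists_pow_mul_exp_neg_le 0 hc
  obtain ⟨K₂, hK₂, hexp₂⟩ := exists_pow_mul_exp_neg_le 2 hc
  set V' : E n → E n →L[ℝ] ℝ := fun x => U x • (Real.exp (-ψ x) • -innerSL ℝ (gradient ψ x))
    + Real.exp (-ψ x) • fderiv ℝ U x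
  have hV' : ∀ x, V' x e = (fderiv ℝ U x e - U x * ⟪gradient ψ x, e⟫) * Real.exp (-ψ x) := by
    intro x
    simp [V']
    ring
  simp_rw [← hV']
  refine integral_hasFDerivAt_eq_zero hn (V := fun x => U x * Real.exp (-ψ x))
    (c := c / 2) (K := C₁ * K₀ + C₀ * C₂ * K₂) (half_pos hc)
    (h.integrable_mul_exp_neg hU.continuousOn hU₀) (fun x hx => ?_) e fun x hx => ?_
  · have h1 := (hUd.differentiableAt (isOpen_compl_singleton.mem_nhds hx)).hasFDerivAt
    have h2 := (hasGradientAt_of_contDiffOn h.contDiffOn hx).hasFDerivAt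
    exact h1.mul h2.neg.exp
  · rw [hV', abs_mul, abs_of_pos (Real.exp_pos _)]
    have h1 := hexp₀ ‖x‖ (norm_nonneg x)
    have h2 := hexp₂ ‖x‖ (norm_nonneg x)
    have h3 : |fderiv ℝ U x e - U x * ⟪gradient ψ x, e⟫|
        ≤ C₁ * ‖x‖ ^ 0 + (C₀ * C₂) * ‖x‖ ^ 2 := by
      refine (abs_sub _ _).trans ?_
      rw [abs_mul]
      have h4 := mul_le_mul (hU₀ x hx) (hψ₁ x hx) (abs_nonneg _) (by positivity)
      have h5 := hU₁ x hx
      linarith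
    calc _ ≤ (C₁ * ‖x‖ ^ 0 + (C₀ * C₂) * ‖x‖ ^ 2) * Real.exp (-c * ‖x‖ ^ 2) := by
          gcongr
          linarith [hψ x]
      _ = C₁ * (‖x‖ ^ 0 * Real.exp (-c * ‖x‖ ^ 2))
          + (C₀ * C₂) * (‖x‖ ^ 2 * Real.exp (-c * ‖x‖ ^ 2)) := by ring
      _ ≤ C₁ * (K₀ * Real.exp (-(c / 2) * ‖x‖ ^ 2))
          + (C₀ * C₂) * (K₂ * Real.exp (-(c / 2) * ‖x‖ ^ 2)) := by gcongr
      _ = _ := by ring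

/-- The one-homogeneous extension of a positive smooth strongly convex support function. -/
structure IsSupportGauge {n : ℕ} (H : E n → ℝ) : Prop where
  map_smul : ∀ (t : ℝ) (x : E n), 0 < t → H (t • x) = t * H x
  contDiffOn : ContDiffOn ℝ (⊤ : ℕ∞) H {0}ᶜ
  pos_of_mem_sphere : ∀ x ∈ sphere (0 : E n) 1, 0 < H x
  hess_pos : ∀ x ∈ sphere (0 : E n) 1, ∀ v : E n, ⟪v, x⟫ = 0 → v ≠ 0 → 0 < ⟪(hess H x) v, v⟫

theorem inv_norm_smul_mem_sphere {n : ℕ} {x : E n} (hx : x ≠ 0) :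
    ‖x‖⁻¹ • x ∈ sphere (0 : E n) 1 := by
  rw [mem_sphere_zero_iff_norm, norm_smul, norm_inv, norm_norm,
    inv_mul_cancel₀ (norm_ne_zero_iff.2 hx)]

theorem inner_hess_comm {n : ℕ} {H : E n → ℝ} (hH : ContDiffOn ℝ (⊤ : ℕ∞) H {0}ᶜ) {x : E n}
    (hx : x ≠ 0) (v w : E n) : ⟪hess H x v, w⟫ = ⟪hess H x w, v⟫ := by
  have hn : {(0 : E n)}ᶜ ∈ 𝓝 x := isOpen_compl_singleton.mem_nhds hx
  have hsymm := (hH.contDiffAt hn).isSymmSndFDerivAt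
    (by rw [minSmoothness_of_isRCLikeNormedField]; exact WithTop.coe_le_coe.2 (le_top (a := (2 : ℕ∞))))
  have h1 : HasFDerivAt (fderiv ℝ H) (fderiv ℝ (fderiv ℝ H) x) x :=
    (((hH.fderiv_of_isOpen (m := (⊤ : ℕ∞)) isOpen_compl_singleton
      (by simp)).differentiableOn (by simp)).differentiableAt hn).hasFDerivAt
  have key : ∀ v w, ⟪hess H x v, w⟫ = fderiv ℝ (fderiv ℝ H) x v w := by
    intro v w
    have h2 : HasFDerivAt (fun y => ⟪gradient H y, w⟫) (innerSL ℝ w ∘L hess H x) x := by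
      simpa [Function.comp_def, real_inner_comm] using
        (innerSL ℝ w).hasFDerivAt.comp x (hasFDerivAt_gradient hH hx)
    have h3 : HasFDerivAt (fun y => ⟪gradient H y, w⟫)
        ((ContinuousLinearMap.apply ℝ ℝ w) ∘L fderiv ℝ (fderiv ℝ H) x) x := by
      simpa [Function.comp_def, gradient] using
        (ContinuousLinearMap.apply ℝ ℝ w).hasFDerivAt.comp x h1
    have h4 := congrArg (fun L => L v) (h2.unique h3)
    simpa [real_inner_comm] using h4
  rw [key, key, hsymm v w]

namespace IsSupportGauge

variable {n : ℕ} {H : E n → ℝ}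

theorem eq_norm_mul (h : IsSupportGauge H) {x : E n} (hx : x ≠ 0) :
    H x = ‖x‖ * H (‖x‖⁻¹ • x) := by
  rw [← h.map_smul _ _ (norm_pos_iff.2 hx), smul_inv_smul₀ (norm_ne_zero_iff.2 hx)]

theorem pos (h : IsSupportGauge H) {x : E n} (hx : x ≠ 0) : 0 < H x := by
  rw [h.eq_norm_mul hx]
  exact mul_pos (norm_pos_iff.2 hx) (h.pos_of_mem_sphere _ (inv_norm_smul_mem_sphere hx))

theorem gradient_smul (h : IsSupportGauge H) (t : ℝ) (x : E n) (ht : 0 < t) (hx : x ≠ 0) :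
    gradient H (t • x) = gradient H x := by
  have := fderiv_homogeneous (k := 0) (h.contDiffOn.differentiableOn (by simp))
    (fun t x ht _ => by simpa using h.map_smul t x ht) t x ht hx
  rw [gradient, this, pow_zero, one_smul, gradient]

theorem inner_gradient_self (h : IsSupportGauge H) {x : E n} (hx : x ≠ 0) :
    ⟪gradient H x, x⟫ = H x := by
  have h1 : HasDerivAt (fun t : ℝ => H (t • x)) ⟪gradient H x, x⟫ 1 := by
    have hg := (hasGradientAt_of_contDiffOn h.contDiffOn hx).hasFDerivAt
    have := HasFDerivAt.comp_hasDerivAt (f := fun t : ℝ => t • x) (l := H) 1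
      (by simpa using hg) ((hasDerivAt_id (1 : ℝ)).smul_const x)
    simpa [Function.comp_def] using this
  have h2 : HasDerivAt (fun t : ℝ => H (t • x)) (H x) 1 := by
    have h3 : HasDerivAt (fun t : ℝ => t * H x) (H x) 1 := by
      simpa using (hasDerivAt_id (1 : ℝ)).mul_const (H x)
    refine h3.congr_of_eventuallyEq ?_
    filter_upwards [lt_mem_nhds (zero_lt_one' ℝ)] with t ht
    exact h.map_smul t x ht
  exact h1.unique h2

theorem hess_apply_self (h : IsSupportGauge H) {x : E n} (hx : x ≠ 0) : hess H x x = 0 := by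
  have h1 : HasDerivAt (fun t : ℝ => gradient H (t • x)) (hess H x x) 1 := by
    have := HasFDerivAt.comp_hasDerivAt (f := fun t : ℝ => t • x) (l := gradient H) 1
      (by simpa using hasFDerivAt_gradient h.contDiffOn hx)
      ((hasDerivAt_id (1 : ℝ)).smul_const x)
    simpa [Function.comp_def] using this
  have h2 : HasDerivAt (fun t : ℝ => gradient H (t • x)) 0 1 := by
    refine (hasDerivAt_const (1 : ℝ) (gradient H x)).congr_of_eventuallyEq ?_
    filter_upwards [lt_mem_nhds (zero_lt_one' ℝ)] with t ht
    exact h.gradient_smul t x ht hx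
  exact h1.unique h2

theorem inner_hess_self (h : IsSupportGauge H) {x : E n} (hx : x ≠ 0) (v : E n) :
    ⟪x, hess H x v⟫ = 0 := by
  rw [real_inner_comm, inner_hess_comm h.contDiffOn hx, h.hess_apply_self hx, inner_zero_left]

theorem contDiffOn_sq (h : IsSupportGauge H) :
    ContDiffOn ℝ (⊤ : ℕ∞) (fun x => H x ^ 2 / 2) {0}ᶜ :=
  (h.contDiffOn.pow 2).div_const 2

theorem gradient_sq (h : IsSupportGauge H) {x : E n} (hx : x ≠ 0) :
    gradient (fun x => H x ^ 2 / 2) x = H x • gradient H x := by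
  have h1 := (hasGradientAt_of_contDiffOn h.contDiffOn hx).hasFDerivAt
  have h2 : HasFDerivAt (fun x => H x ^ 2 / 2)
      (InnerProductSpace.toDual ℝ (E n) (H x • gradient H x)) x := by
    refine ((h1.pow 2).mul_const (2⁻¹ : ℝ)).congr_fderiv ?_
    ext v
    simp
    ring
  exact HasGradientAt.gradient h2

theorem hess_sq_apply (h : IsSupportGauge H) {x : E n} (hx : x ≠ 0) (v : E n) :
    hess (fun x => H x ^ 2 / 2) x v
      = H x • hess H x v + ⟪gradient H x, v⟫ • gradient H x := by
  have h1 := (hasGradientAt_of_contDiffOn h.contDiffOn hx).hasFDerivAt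
  have h2 := h1.smul (hasFDerivAt_gradient h.contDiffOn hx)
  have h3 := h2.congr_of_eventuallyEq (f₁ := gradient fun x => H x ^ 2 / 2) (by
    filter_upwards [isOpen_compl_singleton.mem_nhds hx] with y hy
    exact h.gradient_sq hy)
  have h4 := h3.fderiv
  rw [hess, h4]
  simp

theorem isQuadraticGauge (h : IsSupportGauge H) :
    IsQuadraticGauge fun x => H x ^ 2 / 2 where
  map_smul t x ht := by rw [h.map_smul t x ht]; ring
  contDiffOn := h.contDiffOn_sq
  pos x hx := by have := h.pos hx; positivity
  hess_pos := by
    have key : ∀ x ∈ sphere (0 : E n) 1, ∀ v, v ≠ 0 →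
        0 < ⟪hess (fun x => H x ^ 2 / 2) x v, v⟫ := by
      intro x hx1 v hv
      have hx : x ≠ 0 := ne_zero_of_mem_unit_sphere ⟨x, hx1⟩
      have hnorm : ‖x‖ = 1 := mem_sphere_zero_iff_norm.1 hx1
      have hH := h.pos hx
      set u := v - ⟪x, v⟫ • x with hu
      have hv' : v = u + ⟪x, v⟫ • x := by simp [hu]
      have hux : ⟪u, x⟫ = 0 := by
        rw [hu, inner_sub_left, inner_smul_left, real_inner_self_eq_norm_sq, hnorm,
          real_inner_comm]
        simp
      have h1 : hess H x v = hess H x u := by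
        rw [hv', map_add, _root_.map_smul, h.hess_apply_self hx, smul_zero, add_zero]
      have h2 : ⟪hess H x v, v⟫ = ⟪hess H x u, u⟫ := by
        rw [h1]
        conv_lhs => rw [hv']
        rw [inner_add_right, inner_smul_right, real_inner_comm x, h.inner_hess_self hx,
          mul_zero, add_zero]
      rw [h.hess_sq_apply hx, inner_add_left, inner_smul_left, inner_smul_left, h2]
      simp only [conj_trivial]
      by_cases hu0 : u = 0
      · have h3 : ⟪x, v⟫ ≠ 0 := by
          intro h0
          rw [hu0, h0] at hv'
          simp [hv'] at hv
        have h4 : ⟪gradient H x, v⟫ = ⟪x, v⟫ * H x := by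
          conv_lhs => rw [hv', hu0, zero_add, inner_smul_right, h.inner_gradient_self hx]
        rw [hu0, map_zero, inner_zero_left, mul_zero, zero_add, h4]
        have : ⟪x, v⟫ * H x ≠ 0 := mul_ne_zero h3 hH.ne'
        exact mul_self_pos.2 this
      · have := h.hess_pos x hx1 u hux hu0
        nlinarith [mul_pos hH this, mul_self_nonneg ⟪gradient H x, v⟫]
    intro x hx v hv
    have h1 := fderiv_homogeneous (k := 0) (g := gradient fun x => H x ^ 2 / 2)
      ((contDiffOn_gradient h.contDiffOn_sq).differentiableOn (by simp))
      (fun t y ht hy => by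
        rw [h.gradient_sq hy, h.gradient_sq (smul_ne_zero ht.ne' hy), h.map_smul t y ht,
          h.gradient_smul t y ht hy, zero_add, pow_one, smul_smul])
      ‖x‖⁻¹ x (inv_pos.2 (norm_pos_iff.2 hx)) hx
    rw [pow_zero, one_smul] at h1
    have h2 := key _ (inv_norm_smul_mem_sphere hx) v hv
    rwa [hess, h1] at h2

theorem det_hess_sq (h : IsSupportGauge H) {x : E n} (hx1 : x ∈ sphere (0 : E n) 1) :
    (hess (fun x => H x ^ 2 / 2) x).det = H x ^ (n + 2) * sigmaDet H x := by
  have hx : x ≠ 0 := ne_zero_of_mem_unit_sphere ⟨x, hx1⟩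
  have hnorm : ‖x‖ = 1 := mem_sphere_zero_iff_norm.1 hx1
  have hH := h.pos hx
  have hgx := h.inner_gradient_self hx
  have hgx' : ⟪x, gradient H x⟫ = H x := by rw [real_inner_comm, hgx]
  set T₁ := LinearMap.transvection (innerₗ (E n) x) ((H x)⁻¹ • gradient H x - x) with hT₁
  set T₂ := LinearMap.transvection (innerₗ (E n) (gradient H x - x)) x with hT₂
  have h1 : ((hess (fun x => H x ^ 2 / 2) x : E n →L[ℝ] E n) : E n →ₗ[ℝ] E n)
      = H x • (T₁ ∘ₗ ((hess H x + proj x : E n →L[ℝ] E n) : E n →ₗ[ℝ] E n) ∘ₗ T₂) := by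
    ext1 v
    simp only [ContinuousLinearMap.coe_coe, h.hess_sq_apply hx, hT₁, hT₂,
      LinearMap.smul_apply, LinearMap.comp_apply, LinearMap.transvection.apply,
      innerₗ_apply_apply, map_add, add_apply, proj, _root_.map_smul,
      ContinuousLinearMap.smulRight_apply, innerSL_apply_apply, h.hess_apply_self hx, inner_zero_right,
      h.inner_hess_self hx, inner_sub_left,
      real_inner_self_eq_norm_sq, hnorm]
    match_scalars <;> field_simp <;> ring
  have hd₁ : LinearMap.det T₁ = 1 := by
    rw [hT₁, LinearMap.transvection.det]
    simp only [innerₗ_apply_apply, inner_sub_right, inner_smul_right, hgx',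
      real_inner_self_eq_norm_sq, hnorm]
    field_simp
    ring
  have hd₂ : LinearMap.det T₂ = H x := by
    rw [hT₂, LinearMap.transvection.det]
    simp only [innerₗ_apply_apply, inner_sub_left, hgx, real_inner_self_eq_norm_sq, hnorm]
    ring
  rw [ContinuousLinearMap.det, h1, LinearMap.det_smul, LinearMap.det_comp, LinearMap.det_comp,
    hd₁, hd₂, sigmaDet, finrank_euclideanSpace, Fintype.card_fin]
  ring

theorem abs_det_hess_sq (h : IsSupportGauge H) {p : ℝ}
    (hflow : ∀ x ∈ sphere (0 : E n) 1, (sigmaDet H x)⁻¹ = H x ^ (1 - p)) {x : E n}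
    (hx : x ≠ 0) :
    |(hess (fun x => H x ^ 2 / 2) x).det| = (H x / ‖x‖) ^ ((n : ℝ) + 1 + p) := by
  have hx' : 0 < ‖x‖⁻¹ := inv_pos.2 (norm_pos_iff.2 hx)
  have hu := inv_norm_smul_mem_sphere hx
  rw [← h.isQuadraticGauge.hess_smul ‖x‖⁻¹ x hx' hx, h.det_hess_sq hu, ← inv_inv (sigmaDet H _),
    hflow _ hu, h.map_smul _ _ hx', inv_mul_eq_div]
  have hpos : 0 < H x / ‖x‖ := div_pos (h.pos hx) (norm_pos_iff.2 hx)
  rw [← Real.rpow_neg hpos.le, ← Real.rpow_natCast, ← Real.rpow_add hpos, abs_of_pos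
    (Real.rpow_pos_of_pos hpos _)]
  congr 1
  push_cast
  ring

end IsSupportGauge

namespace IsQuadraticGauge

variable {n : ℕ} {ψ : E n → ℝ}

theorem integrable_inner_gradient_mul (h : IsQuadraticGauge ψ) {D : E n → ℝ}
    (hD : ContDiffOn ℝ 1 D {0}ᶜ) (hDhom : ∀ (t : ℝ) (x : E n), 0 < t → x ≠ 0 → D (t • x) = D x)
    (e : E n) :
    Integrable fun x => fderiv ℝ D x e * ⟪gradient ψ x, e⟫ * Real.exp (-ψ x) := by
  have hg : ContinuousOn (fun x => fderiv ℝ D x e * ⟪gradient ψ x, e⟫) {0}ᶜ :=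
    ((hD.fderiv_of_isOpen (m := 0) isOpen_compl_singleton (by simp)).continuousOn.clm_apply
      continuousOn_const).mul
      ((contDiffOn_gradient h.contDiffOn).continuousOn.inner continuousOn_const)
  obtain ⟨C, -, hC⟩ := exists_bound_of_homogeneous (k := 0) hg fun t x ht hx => by
    have h1 : HasFDerivAt (fun y => D (t • y))
        ((fderiv ℝ D (t • x)).comp (t • ContinuousLinearMap.id ℝ (E n))) x :=
      (((hD.differentiableOn (by simp)).differentiableAt (isOpen_compl_singleton.mem_nhds
        (smul_ne_zero ht.ne' hx))).hasFDerivAt).comp x ((hasFDerivAt_id x).const_smul t)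
    have h2 : fderiv ℝ (fun y => D (t • y)) x = fderiv ℝ D x := by
      refine Filter.EventuallyEq.fderiv_eq ?_
      filter_upwards [isOpen_compl_singleton.mem_nhds hx] with y hy
      exact hDhom t y ht hy
    have h3 := congrArg (fun L => L e) (h1.fderiv.symm.trans h2)
    simp only [ContinuousLinearMap.comp_apply, smul_apply,
      ContinuousLinearMap.id_apply, _root_.map_smul, smul_eq_mul] at h3
    rw [h.gradient_smul t x ht hx, inner_smul_left, ← h3]
    simp only [conj_trivial]
    ring
  exact h.integrable_mul_exp_neg hg hC

theorem integral_fderiv_det_mul_le (h : IsQuadraticGauge ψ) (hn : 1 ≤ n) {D : E n → ℝ}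
    (hD : ContDiffOn ℝ 1 D {0}ᶜ) (hdet : ∀ x, x ≠ 0 → |(hess ψ x).det| = D x) (e : E n)
    (hcent : ∫ x, ⟪x, e⟫ * Real.exp (-legendre ψ x) = 0) :
    ∫ x, fderiv ℝ D x e * ⟪gradient ψ x, e⟫ * Real.exp (-ψ x) ≤ 0 := by
  have hDhom : ∀ (t : ℝ) (x : E n), 0 < t → x ≠ 0 → D (t • x) = D x := fun t x ht hx => by
    rw [← hdet x hx, ← hdet _ (smul_ne_zero ht.ne' hx), h.hess_smul t x ht hx]
  have hgc : ContDiffOn ℝ 1 (fun x => ⟪gradient ψ x, e⟫) {0}ᶜ :=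
    ((contDiffOn_gradient h.contDiffOn).of_le (by simp)).inner ℝ contDiffOn_const
  have hibp := h.integral_fderiv_sub_mul_exp hn (U := fun x => ⟪gradient ψ x, e⟫ * D x)
    (hgc.mul hD) (fun t x ht hx => by
      rw [h.gradient_smul t x ht hx, hDhom t x ht hx, inner_smul_left, mul_assoc]; simp) e
  have hBL := h.brascamp_lieb hn e hcent
  obtain ⟨M, hM₀, hM⟩ := h.exists_det_bound
  obtain ⟨C₁, hC₁, hg⟩ := h.exists_gradient_bound e
  obtain ⟨C₂, hC₂, hh⟩ := h.exists_hess_bound e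
  have i1 : Integrable fun y => ⟪gradient ψ y, e⟫ ^ 2 * |(hess ψ y).det| * Real.exp (-ψ y) := by
    refine h.integrable_mul_exp_neg (k := 2) (C := C₁ ^ 2 * M)
      ((hgc.continuousOn.pow 2).mul h.continuousOn_det) fun x hx => ?_
    rw [abs_mul, abs_pow, abs_abs]
    calc _ ≤ (C₁ * ‖x‖) ^ 2 * M := by gcongr; exacts [hg x hx, hM x hx]
      _ = _ := by ring
  have i2 : Integrable fun y => ⟪hess ψ y e, e⟫ * |(hess ψ y).det| * Real.exp (-ψ y) := by
    refine h.integrable_mul_exp_neg (k := 0) (C := C₂ * M)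
      ((((continuousOn_hess h.contDiffOn).clm_apply continuousOn_const).inner
        continuousOn_const).mul h.continuousOn_det) fun x hx => ?_
    rw [abs_mul, abs_abs, pow_zero, mul_one]
    gcongr
    exacts [hh x hx, hM x hx]
  have i3 := h.integrable_inner_gradient_mul hD hDhom e
  have hsum : ∫ x, (fderiv ℝ D x e * ⟪gradient ψ x, e⟫ * Real.exp (-ψ x)
      + (⟪hess ψ x e, e⟫ * |(hess ψ x).det| * Real.exp (-ψ x)
        - ⟪gradient ψ x, e⟫ ^ 2 * |(hess ψ x).det| * Real.exp (-ψ x))) = 0 := by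
    rw [← hibp]
    refine integral_congr_ae ?_
    filter_upwards [ae_ne_zero n] with x hx
    have h1 : HasFDerivAt (fun x => ⟪gradient ψ x, e⟫) (innerSL ℝ e ∘L hess ψ x) x := by
      simpa [Function.comp_def, real_inner_comm] using
        (innerSL ℝ e).hasFDerivAt.comp x (hasFDerivAt_gradient h.contDiffOn hx)
    have h2 := ((hD.differentiableOn (by simp)).differentiableAt
      (isOpen_compl_singleton.mem_nhds hx)).hasFDerivAt
    rw [(h1.fun_mul h2).fderiv, hdet x hx]
    simp only [add_apply, smul_apply, ContinuousLinearMap.comp_apply, innerSL_apply_apply,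
      smul_eq_mul, real_inner_comm e]
    ring
  have i21 : Integrable fun x => ⟪hess ψ x e, e⟫ * |(hess ψ x).det| * Real.exp (-ψ x)
      - ⟪gradient ψ x, e⟫ ^ 2 * |(hess ψ x).det| * Real.exp (-ψ x) := i2.sub i1
  rw [integral_add i3 i21, integral_sub i2 i1] at hsum
  simp only [← mul_assoc] at hBL
  linarith

end IsQuadraticGauge

namespace IsSupportGauge

variable {n : ℕ} {H : E n → ℝ}

theorem hasGradientAt_div_norm (h : IsSupportGauge H) {x : E n} (hx : x ≠ 0) :
    HasGradientAt (fun x => H x / ‖x‖) (‖x‖⁻¹ • gradient H x - (H x / ‖x‖ ^ 3) • x) x := by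
  have hx' : ‖x‖ ≠ 0 := norm_ne_zero_iff.2 hx
  have h1 := (hasGradientAt_of_contDiffOn h.contDiffOn hx).hasFDerivAt
  have h2 : HasFDerivAt (fun x : E n => ‖x‖) (‖x‖⁻¹ • innerSL ℝ x) x := by
    have h3 := ((hasStrictFDerivAt_norm_sq x).hasFDerivAt).sqrt (by positivity)
    simp only [Real.sqrt_sq (norm_nonneg _)] at h3
    refine h3.congr_fderiv ?_
    ext v
    simp
    field_simp
  rw [hasGradientAt_iff_hasFDerivAt]
  refine (h1.fun_mul ((hasDerivAt_inv hx').comp_hasFDerivAt x h2)).congr_fderiv ?_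
  ext v
  have h4 : (InnerProductSpace.toDual ℝ (E n) (gradient H x)) v = ⟪gradient H x, v⟫ := by simp
  simp only [add_apply, smul_apply, Function.comp_apply, h4, innerSL_apply_apply, smul_eq_mul,
    InnerProductSpace.toDual_apply_apply, inner_sub_left, inner_smul_left, conj_trivial]
  field_simp
  ring

theorem contDiffOn_div_norm (h : IsSupportGauge H) :
    ContDiffOn ℝ (⊤ : ℕ∞) (fun x => H x / ‖x‖) {0}ᶜ :=
  h.contDiffOn.div (contDiffOn_id.norm ℝ fun _ hx => hx) fun _ hx => norm_ne_zero_iff.2 hx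

theorem inner_gradient_gradient_div_norm (h : IsSupportGauge H) {x : E n} (hx : x ≠ 0) :
    ⟪gradient H x, gradient (fun x => H x / ‖x‖) x⟫
      = ‖x‖ * ‖gradient (fun x => H x / ‖x‖) x‖ ^ 2 := by
  have hx' : ‖x‖ ≠ 0 := norm_ne_zero_iff.2 hx
  have h1 := h.inner_gradient_self hx
  have h2 : ⟪x, gradient H x⟫ = H x := by rw [real_inner_comm, h1]
  rw [← real_inner_self_eq_norm_sq, (h.hasGradientAt_div_norm hx).gradient]
  simp only [inner_sub_left, inner_sub_right, inner_smul_left, inner_smul_right, conj_trivial,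
    h1, h2, real_inner_self_eq_norm_sq x]
  field_simp
  ring

theorem gradient_div_norm_eq_zero (h : IsSupportGauge H) (hn : 1 ≤ n) {p : ℝ}
    (hp : -((n : ℝ) + 1) < p)
    (hflow : ∀ x ∈ sphere (0 : E n) 1, (sigmaDet H x)⁻¹ = H x ^ (1 - p))
    (hcent : ∀ e : E n, ∫ x, ⟪x, e⟫ * Real.exp (-legendre (fun x => H x ^ 2 / 2) x) = 0)
    {x : E n} (hx : x ≠ 0) : gradient (fun x => H x / ‖x‖) x = 0 := by
  set q : ℝ := (n : ℝ) + 1 + p with hq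
  have hq0 : 0 < q := by linarith
  have hψ := h.isQuadraticGauge
  set ψ : E n → ℝ := fun x => H x ^ 2 / 2 with hψdef
  set G : E n → ℝ := fun x => H x / ‖x‖ with hG
  have hGpos : ∀ x, x ≠ 0 → 0 < G x := fun x hx => div_pos (h.pos hx) (norm_pos_iff.2 hx)
  set D : E n → ℝ := fun x => G x ^ q with hDdef
  have hD : ContDiffOn ℝ 1 D {0}ᶜ :=
    (h.contDiffOn_div_norm.of_le (by simp)).rpow_const_of_ne fun x hx => (hGpos x hx).ne'
  have hdet : ∀ x, x ≠ 0 → |(hess ψ x).det| = D x := fun x hx => h.abs_det_hess_sq hflow hx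
  have hDhom : ∀ (t : ℝ) (x : E n), 0 < t → x ≠ 0 → D (t • x) = D x := fun t x ht hx => by
    rw [← hdet x hx, ← hdet _ (smul_ne_zero ht.ne' hx), hψ.hess_smul t x ht hx]
  have hDg : ∀ x, x ≠ 0 → ∀ e, fderiv ℝ D x e = q * G x ^ (q - 1) * ⟪gradient G x, e⟫ := by
    intro x hx e
    have h1 := (h.hasGradientAt_div_norm hx).differentiableAt.hasGradientAt.hasFDerivAt
    rw [(h1.rpow_const (p := q) (Or.inl (hGpos x hx).ne')).fderiv]
    simp [hG]
  set b := stdOrthonormalBasis ℝ (E n)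
  set I : E n → ℝ := fun x => q * G x ^ q * ‖x‖ ^ 2 * ‖gradient G x‖ ^ 2 * Real.exp (-ψ x)
    with hI
  have hIsum : ∀ x, x ≠ 0 → ∑ i, fderiv ℝ D x (b i) * ⟪gradient ψ x, b i⟫ * Real.exp (-ψ x)
      = I x := by
    intro x hx
    have hx' : 0 < ‖x‖ := norm_pos_iff.2 hx
    have h1 : ∑ i, ⟪gradient G x, b i⟫ * ⟪gradient ψ x, b i⟫
        = ⟪gradient ψ x, gradient G x⟫ := by
      rw [← b.sum_inner_mul_inner]
      exact Finset.sum_congr rfl fun i _ => by rw [mul_comm, real_inner_comm (b i) (gradient G x)]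
    have h2 : ∀ i, fderiv ℝ D x (b i) * ⟪gradient ψ x, b i⟫ * Real.exp (-ψ x)
        = q * G x ^ (q - 1) * Real.exp (-ψ x) * (⟪gradient G x, b i⟫ * ⟪gradient ψ x, b i⟫) := by
      intro i
      rw [hDg x hx]
      ring
    simp only [h2]
    rw [← Finset.mul_sum, h1, h.gradient_sq hx, inner_smul_left,
      h.inner_gradient_gradient_div_norm hx, hI]
    have h3 : G x ^ q = G x ^ (q - 1) * G x := by
      rw [← Real.rpow_add_one (hGpos x hx).ne']
      ring_nf
    have h4 : H x = G x * ‖x‖ := by simp only [hG]; field_simp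
    simp only [conj_trivial]
    rw [h3, h4]
    ring
  have hint : ∀ i, Integrable fun x =>
      fderiv ℝ D x (b i) * ⟪gradient ψ x, b i⟫ * Real.exp (-ψ x) :=
    fun i => hψ.integrable_inner_gradient_mul hD hDhom (b i)
  have hae : (fun x => ∑ i, fderiv ℝ D x (b i) * ⟪gradient ψ x, b i⟫ * Real.exp (-ψ x))
      =ᵐ[volume] I := by
    filter_upwards [ae_ne_zero n] with x hx using hIsum x hx
  have hIint : Integrable I := (integrable_finsetSum _ fun i _ => hint i).congr hae
  have hI0 : 0 ≤ᵐ[volume] I := by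
    filter_upwards [ae_ne_zero n] with x hx
    have := Real.rpow_pos_of_pos (hGpos x hx) q
    simp only [hI, Pi.zero_apply]
    positivity
  have hIle : ∫ x, I x ≤ 0 := by
    rw [← integral_congr_ae hae, integral_finsetSum _ fun i _ => hint i]
    exact Finset.sum_nonpos fun i _ =>
      hψ.integral_fderiv_det_mul_le hn hD hdet (b i) (hcent _)
  have hIz : I =ᵐ[volume] 0 :=
    (integral_eq_zero_iff_of_nonneg_ae hI0 hIint).1 (hIle.antisymm (integral_nonneg_of_ae hI0))
  have hGz : gradient G =ᵐ[volume] fun _ => 0 := by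
    filter_upwards [hIz, ae_ne_zero n] with x hIx hx
    have := (Real.rpow_pos_of_pos (hGpos x hx) q).ne'
    have hx' : ‖x‖ ≠ 0 := norm_ne_zero_iff.2 hx
    simpa [hI, hq0.ne', this, hx, (Real.exp_pos _).ne'] using hIx
  exact Measure.eqOn_open_of_ae_eq (ae_restrict_of_ae hGz) isOpen_compl_singleton
    (contDiffOn_gradient h.contDiffOn_div_norm).continuousOn continuousOn_const hx

theorem exists_eq_mul_norm (h : IsSupportGauge H) (hn : 1 ≤ n) {p : ℝ}
    (hp : -((n : ℝ) + 1) < p)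
    (hflow : ∀ x ∈ sphere (0 : E n) 1, (sigmaDet H x)⁻¹ = H x ^ (1 - p))
    (hcent : ∀ e : E n, ∫ x, ⟪x, e⟫ * Real.exp (-legendre (fun x => H x ^ 2 / 2) x) = 0) :
    ∃ r, ∀ x ∈ sphere (0 : E n) 1, H x = r := by
  have hrank : 1 < Module.rank ℝ (E n) := by
    rw [← Module.finrank_eq_rank, finrank_euclideanSpace, Fintype.card_fin]
    exact_mod_cast Nat.lt_succ_of_le hn
  obtain ⟨r, hr⟩ := isOpen_compl_singleton.exists_is_const_of_fderiv_eq_zero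
    (isConnected_compl_singleton_of_one_lt_rank hrank (0 : E n)).isPreconnected
    (h.contDiffOn_div_norm.differentiableOn (by simp)) (fun x hx => by
      have h1 := (h.hasGradientAt_div_norm hx).differentiableAt.hasGradientAt
      rw [h.gradient_div_norm_eq_zero hn hp hflow hcent hx] at h1
      simpa using h1.hasFDerivAt.fderiv)
  refine ⟨r, fun x hx => ?_⟩
  have h1 := hr x (ne_zero_of_mem_unit_sphere ⟨x, hx⟩)
  rwa [mem_sphere_zero_iff_norm.1 hx, div_one] at h1

end IsSupportGauge

theorem body_eq_closedBall {n : ℕ} {H : E n → ℝ} {r : ℝ} (hr : 0 < r)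
    (h : ∀ x ∈ sphere (0 : E n) 1, H x = r) : body H = closedBall 0 r := by
  ext y
  rw [mem_closedBall_zero_iff]
  constructor
  · intro hy
    by_cases hy0 : y = 0
    · simpa [hy0] using hr.le
    · have h1 := hy _ (inv_norm_smul_mem_sphere hy0)
      rw [h _ (inv_norm_smul_mem_sphere hy0), inner_smul_right, real_inner_self_eq_norm_sq] at h1
      have h2 := norm_ne_zero_iff.2 hy0
      field_simp at h1
      exact h1
  · intro hy x hx
    rw [h x hx]
    have h1 := real_inner_le_norm y x
    rw [mem_sphere_zero_iff_norm.1 hx] at h1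
    linarith

theorem isClosed_body {n : ℕ} (H : E n → ℝ) : IsClosed (body H) := by
  have h1 : body H = ⋂ x ∈ sphere (0 : E n) 1, {y | ⟪y, x⟫ ≤ H x} := by
    ext y
    simp [body]
  rw [h1]
  exact isClosed_biInter fun x _ => isClosed_le (by fun_prop) continuous_const

namespace IsSupportGauge

variable {n : ℕ} {H : E n → ℝ}

theorem isCompact_body (h : IsSupportGauge H) : IsCompact (body H) := by
  obtain ⟨C, hC, hb⟩ := exists_bound_of_homogeneous (k := 1) h.contDiffOn.continuousOn
    (fun t x ht _ => by simpa using h.map_smul t x ht)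
  refine isCompact_of_isClosed_isBounded (isClosed_body H)
    (isBounded_iff_subset_closedBall 0 |>.2 ⟨C, fun y hy => ?_⟩)
  rw [mem_closedBall_zero_iff]
  by_cases hy0 : y = 0
  · simpa [hy0] using hC
  · have hu := inv_norm_smul_mem_sphere hy0
    have h1 := hy _ hu
    have h2 : H (‖y‖⁻¹ • y) ≤ C := by
      have := (le_abs_self _).trans (hb _ (ne_zero_of_mem_unit_sphere ⟨_, hu⟩))
      simpa [mem_sphere_zero_iff_norm.1 hu] using this
    have h3 : ‖y‖⁻¹ * ‖y‖ ^ 2 = ‖y‖ := by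
      have := norm_ne_zero_iff.2 hy0
      field_simp
    rw [inner_smul_right, real_inner_self_eq_norm_sq, h3] at h1
    exact h1.trans h2

theorem integral_body_inner_eq_zero (h : IsSupportGauge H)
    (hcentroid : ∫ y in body H, y = 0) (e : E n) : ∫ x in body H, ⟪x, e⟫ = 0 := by
  have h1 : IntegrableOn (fun x : E n => x) (body H) :=
    continuousOn_id.integrableOn_compact h.isCompact_body
  have h2 : ∫ x in body H, ⟪e, x⟫ = ⟪e, ∫ x in body H, x⟫ := integral_inner h1 e
  rw [hcentroid, inner_zero_right] at h2
  simpa only [real_inner_comm e] using h2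

theorem map_zero (h : IsSupportGauge H) : H 0 = 0 := by
  have := h.map_smul 2 0 (by norm_num)
  rw [smul_zero] at this
  linarith

theorem legendre_sq_le_iff (h : IsSupportGauge H) {c : ℝ} (hc : 0 < c) (x : E n) :
    legendre (fun x => H x ^ 2 / 2) x ≤ c ^ 2 / 2 ↔ c⁻¹ • x ∈ body H := by
  constructor
  · intro hx u hu
    have hHu := h.pos_of_mem_sphere u hu
    have h1 := (h.isQuadraticGauge.le_legendre x ((c / H u) • u)).trans hx
    rw [h.map_smul _ _ (by positivity), inner_smul_right] at h1
    rw [inner_smul_left, conj_trivial, inv_mul_le_iff₀ hc]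
    have h2 : c / H u * H u = c := by field_simp
    rw [h2] at h1
    have h3 : c / H u * ⟪x, u⟫ ≤ c / H u * (c * H u) := by
      have : c / H u * (c * H u) = c ^ 2 := by field_simp
      linarith
    exact le_of_mul_le_mul_left h3 (by positivity)
  · intro hx
    refine ciSup_le fun y => ?_
    by_cases hy : y = 0
    · simp only [hy, inner_zero_right, h.map_zero]
      have := sq_nonneg c
      linarith
    · have h1 := hx _ (inv_norm_smul_mem_sphere hy)
      rw [inner_smul_left, inner_smul_right, h.map_smul _ _ (inv_pos.2 (norm_pos_iff.2 hy)),
        conj_trivial] at h1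
      have h3 := norm_pos_iff.2 hy
      have h2 : ⟪x, y⟫ ≤ c * H y := by
        field_simp at h1
        linarith
      nlinarith [sq_nonneg (c - H y)]

theorem integral_indicator_legendre_sq_le (h : IsSupportGauge H)
    (hcentroid : ∫ y in body H, y = 0) (e : E n) {s : ℝ} (hs : 0 < s) :
    ∫ x, {x | legendre (fun x => H x ^ 2 / 2) x ≤ s}.indicator (fun x => ⟪x, e⟫) x = 0 := by
  set c := √(2 * s) with hc
  have hc0 : 0 < c := by positivity
  have hcs : s = c ^ 2 / 2 := by
    rw [hc, Real.sq_sqrt (by positivity)]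
    ring
  have h1 : ∀ x, {x | legendre (fun x => H x ^ 2 / 2) x ≤ s}.indicator (fun x => ⟪x, e⟫) x
      = c * (body H).indicator (fun x => ⟪x, e⟫) (c⁻¹ • x) := by
    intro x
    have h2 := h.legendre_sq_le_iff hc0 x
    rw [← hcs] at h2
    by_cases hx : legendre (fun x => H x ^ 2 / 2) x ≤ s
    · rw [indicator_of_mem (by exact hx), indicator_of_mem (h2.1 hx), inner_smul_left,
        conj_trivial, mul_inv_cancel_left₀ hc0.ne']
    · rw [indicator_of_notMem (by exact hx), indicator_of_notMem (fun h3 => hx (h2.2 h3)),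
        mul_zero]
  simp_rw [h1]
  rw [integral_const_mul, Measure.integral_comp_smul volume
    ((body H).indicator fun x => ⟪x, e⟫), integral_indicator (isClosed_body H).measurableSet, h.integral_body_inner_eq_zero hcentroid]
  simp

theorem integral_inner_mul_exp_neg_legendre_sq (h : IsSupportGauge H)
    (hcentroid : ∫ y in body H, y = 0) (e : E n) :
    ∫ x, ⟪x, e⟫ * Real.exp (-legendre (fun x => H x ^ 2 / 2) x) = 0 := by
  have hψ := h.isQuadraticGauge
  set φ := legendre fun x => H x ^ 2 / 2 with hφ
  have hm : Measurable φ := hψ.measurable_legendre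
  set f : E n → ℝ → ℝ := fun x s => ⟪x, e⟫ * (Ici (φ x)).indicator (fun s => Real.exp (-s)) s
    with hf
  have hexp : ∀ a : ℝ, ∫ s, (Ici a).indicator (fun s => Real.exp (-s)) s = Real.exp (-a) := by
    intro a
    rw [integral_indicator measurableSet_Ici, integral_Ici_eq_integral_Ioi, integral_exp_neg_Ioi]
  have hexpi : ∀ a : ℝ, Integrable fun s => (Ici a).indicator (fun s => Real.exp (-s)) s := by
    intro a
    rw [integrable_indicator_iff measurableSet_Ici, integrableOn_Ici_iff_integrableOn_Ioi]
    exact integrableOn_exp_neg_Ioi a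
  have hfm : Measurable (Function.uncurry f) := by
    have h1 : MeasurableSet {z : E n × ℝ | φ z.1 ≤ z.2} :=
      measurableSet_le (by fun_prop) (by fun_prop)
    have h2 : Measurable fun z : E n × ℝ => Real.exp (-z.2) := by fun_prop
    have h3 : Measurable fun z : E n × ℝ => ⟪z.1, e⟫ := by fun_prop
    exact h3.mul (h2.indicator h1)
  have hfi : Integrable (Function.uncurry f) (volume.prod volume) := by
    rw [integrable_prod_iff hfm.aestronglyMeasurable]
    refine ⟨Eventually.of_forall fun x => (hexpi (φ x)).const_mul ⟪x, e⟫, ?_⟩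
    have h1 : (fun x => ∫ s, ‖Function.uncurry f (x, s)‖)
        = fun x => ‖⟪x, e⟫ * Real.exp (-φ x)‖ := by
      funext x
      simp only [Function.uncurry_apply_pair, hf, norm_mul, norm_indicator_eq_indicator_norm,
        Real.norm_of_nonneg (Real.exp_pos _).le]
      rw [integral_const_mul, hexp]
    rw [h1]
    simpa using (hψ.integrable_inner_pow_mul_exp e 1).norm
  have h1 := integral_integral_swap hfi
  simp only [hf, integral_const_mul, hexp] at h1
  rw [h1]
  refine integral_eq_zero_of_ae ?_
  filter_upwards [compl_mem_ae_iff.2 (measure_singleton (0 : ℝ))] with s hs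
  have h2 : ∀ x, ⟪x, e⟫ * (Ici (φ x)).indicator (fun s => Real.exp (-s)) s
      = Real.exp (-s) * {x | φ x ≤ s}.indicator (fun x => ⟪x, e⟫) x := by
    intro x
    by_cases hx : φ x ≤ s
    · rw [indicator_of_mem (by exact hx), indicator_of_mem (by exact hx), mul_comm]
    · rw [indicator_of_notMem (by exact hx), indicator_of_notMem (by exact hx), mul_zero,
        mul_zero]
  simp only [h2, Pi.zero_apply]
  rw [integral_const_mul]
  rcases lt_or_gt_of_ne hs with hs | hs
  · obtain ⟨c, hc, hb⟩ := hψ.exists_legendre_lower_bound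
    have h3 : {x | φ x ≤ s} = ∅ := by
      ext x
      have := hb x
      have h4 : 0 ≤ c * ‖x‖ ^ 2 := by positivity
      simp only [mem_ofPred_eq, mem_empty_iff_false, iff_false, not_le]
      linarith
    simp [h3]
  · rw [h.integral_indicator_legendre_sq_le hcentroid e hs, mul_zero]

end IsSupportGauge

theorem IsSupportGauge.map_eq_of_centroid_of_line {H : E 0 → ℝ} (h : IsSupportGauge H)
    (hcentroid : ∫ y in body H, y = 0) :
    ∃ r, ∀ x ∈ sphere (0 : E 0) 1, H x = r := by
  set e : E 0 := EuclideanSpace.single 0 1 with he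
  have hes : e ∈ sphere (0 : E 0) 1 := by simp [he]
  have hes' : -e ∈ sphere (0 : E 0) 1 := by simp [he]
  have hsphere : ∀ x ∈ sphere (0 : E 0) 1, x = e ∨ x = -e := by
    intro x hx
    have h1 : |x 0| = 1 := by
      have := mem_sphere_zero_iff_norm.1 hx
      simpa [EuclideanSpace.norm_eq, Real.sqrt_sq_eq_abs] using this
    rcases eq_or_eq_neg_of_abs_eq h1 with h1 | h1
    · left
      ext i
      fin_cases i
      simpa [he] using h1
    · right
      ext i
      fin_cases i
      simpa [he] using h1
  have hinner : ∀ y : E 0, ⟪y, e⟫ = y 0 := fun y => by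
    rw [he, EuclideanSpace.inner_single_right]
    simp
  have ha := h.pos_of_mem_sphere e hes
  have hb := h.pos_of_mem_sphere (-e) hes'
  set m : E 0 ≃ᵐ ℝ := (MeasurableEquiv.toLp 2 (Fin 1 → ℝ)).symm.trans
    (MeasurableEquiv.funUnique (Fin 1) ℝ) with hm
  have hmp : MeasurePreserving m :=
    (volume_preserving_funUnique (Fin 1) ℝ).comp
      (EuclideanSpace.volume_preserving_symm_measurableEquiv_toLp (Fin 1))
  have hmx : ∀ y, m y = y 0 := fun y => rfl
  have hbody : body H = m ⁻¹' Icc (-H (-e)) (H e) := by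
    ext y
    rw [mem_preimage, hmx, mem_Icc, ← hinner y]
    constructor
    · intro hy
      have h1 := hy _ hes'
      rw [inner_neg_right] at h1
      exact ⟨by linarith, hy _ hes⟩
    · rintro ⟨h1, h2⟩ x hx
      rcases hsphere x hx with rfl | rfl
      · exact h2
      · rw [inner_neg_right]
        linarith
  have h0 := integral_body_inner_eq_zero h hcentroid e
  simp only [hinner, ← hmx] at h0
  rw [hbody, hmp.setIntegral_preimage_emb m.measurableEmbedding (fun t => t),
    integral_Icc_eq_integral_Ioc, ← intervalIntegral.integral_of_le (by linarith),
    integral_id] at h0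
  have hab : H (-e) = H e := by nlinarith
  refine ⟨H e, fun x hx => ?_⟩
  rcases hsphere x hx with rfl | rfl
  · rfl
  · exact hab

end

/-- Isotropic `L^p`-Minkowski problem, `p > -(n+1)`, origin-centred case: if
`𝒦 = h^{1-p}` and the centroid of the body is at the origin, the body is an
origin-centred ball. -/
theorem stmt13 (n : ℕ) (p : ℝ) (hp : -((n : ℝ) + 1) < p) (H : E n → ℝ)
    (hhom : ∀ (t : ℝ) (x : E n), 0 < t → H (t • x) = t * H x)
    (hsmooth : ContDiffOn ℝ (⊤ : ℕ∞) H {(0 : E n)}ᶜ)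
    (hpos : ∀ x ∈ sphere (0 : E n) 1, 0 < H x)
    (hconvex : ∀ x ∈ sphere (0 : E n) 1, ∀ v : E n, ⟪v, x⟫ = 0 → v ≠ 0 →
      0 < ⟪(hess H x) v, v⟫)
    (hflow : ∀ x ∈ sphere (0 : E n) 1, (sigmaDet H x)⁻¹ = H x ^ (1 - p))
    (hcentroid : ∫ y in body H, y = 0) :
    ∃ r : ℝ, 0 < r ∧ body H = Metric.closedBall (0 : E n) r := by
  have h : IsSupportGauge H := ⟨hhom, hsmooth, hpos, hconvex⟩
  obtain ⟨r, hr⟩ : ∃ r, ∀ x ∈ sphere (0 : E n) 1, H x = r := by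
    rcases n.eq_zero_or_pos with rfl | hn
    · exact h.map_eq_of_centroid_of_line hcentroid
    · exact h.exists_eq_mul_norm hn hp hflow (h.integral_inner_mul_exp_neg_legendre_sq hcentroid)
  have hs : EuclideanSpace.single 0 1 ∈ sphere (0 : E n) 1 := by simp
  have hr0 : 0 < r := hr _ hs ▸ hpos _ hs
  exact ⟨r, hr0, body_eq_closedBall hr0 hr⟩

end
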